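/- arXiv:1710.04303 — 10 statements merged into one kernel-verified Lean document; each statement's English description precedes it below -/
import Mathlib

section
/- Let T = (K,L,R) and let b be a b_T-sequence. Let h ≥ 2 be a natural number coprime to r, and suppose that k_{n+1} − k_n ≥ h + u − 1 for all but finitely many n. Then at least one of the following holds: (1) all but finitely many values b(n) are divisible by h; (2) all but finitely many values b(n) satisfy gcd(b(n), h) > 1, and condition (1) does not hold; (3) for every sequence d : ℕ → ℤ satisfying d(N) − d(N−1) = ∑_{i=0}^t l_i·b(k_{N−i}) for all N ≥ 1, every residue class modulo h appears infinitely many times in the sequence (d(N) mod h)_{N≥0}. Moreover, condition (1) cannot hold simultaneously with condition (2) or with condition (3). -/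
/-- Theorem 1 (TwMain) of the paper. -/
theorem stmt_0
    (k b : ℤ → ℤ) (t u : ℕ) (l r : ℕ → ℤ)
    (hk0 : k 0 = 0) (hkmono : StrictMono k)
    (hkneg : ∀ z : ℤ, z < 0 → k z = z)
    (hbneg : ∀ z : ℤ, z < 0 → b z = 0)
    (hflat : ∀ n : ℕ, ∀ j : ℤ, k (n : ℤ) ≤ j → j < k ((n : ℤ) + 1) → b j = b (k (n : ℤ)))
    (hrec : ∀ n : ℤ, 1 ≤ n →
      ∑ i ∈ Finset.range (t + 1), l i * b (k (n - (i : ℤ))) =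
      ∑ j ∈ Finset.range (u + 1), r j * b (n - (j : ℤ)))
    (h : ℕ) (hh : 2 ≤ h)
    (hcop : IsCoprime ((h : ℤ)) (∑ j ∈ Finset.range (u + 1), r j))
    (hgap : ∃ N : ℕ, ∀ n : ℕ, N ≤ n →
      (h : ℤ) + (u : ℤ) - 1 ≤ k ((n : ℤ) + 1) - k (n : ℤ)) :
    ((∃ N : ℕ, ∀ n : ℕ, N ≤ n → (h : ℤ) ∣ b (n : ℤ)) ∨
      ((∃ N : ℕ, ∀ n : ℕ, N ≤ n → 1 < Int.gcd (b (n : ℤ)) (h : ℤ)) ∧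
        ¬ (∃ N : ℕ, ∀ n : ℕ, N ≤ n → (h : ℤ) ∣ b (n : ℤ))) ∨
      (∀ d : ℕ → ℤ,
        (∀ N : ℕ, 1 ≤ N →
          d N - d (N - 1) = ∑ i ∈ Finset.range (t + 1), l i * b (k ((N : ℤ) - (i : ℤ)))) →
        ∀ c : ℤ, {N : ℕ | d N ≡ c [ZMOD (h : ℤ)]}.Infinite)) ∧
    ¬ ((∃ N : ℕ, ∀ n : ℕ, N ≤ n → (h : ℤ) ∣ b (n : ℤ)) ∧
        ((∃ N : ℕ, ∀ n : ℕ, N ≤ n → 1 < Int.gcd (b (n : ℤ)) (h : ℤ)) ∧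
          ¬ (∃ N : ℕ, ∀ n : ℕ, N ≤ n → (h : ℤ) ∣ b (n : ℤ)))) ∧
    ¬ ((∃ N : ℕ, ∀ n : ℕ, N ≤ n → (h : ℤ) ∣ b (n : ℤ)) ∧
        (∀ d : ℕ → ℤ,
          (∀ N : ℕ, 1 ≤ N →
            d N - d (N - 1) = ∑ i ∈ Finset.range (t + 1), l i * b (k ((N : ℤ) - (i : ℤ)))) →
          ∀ c : ℤ, {N : ℕ | d N ≡ c [ZMOD (h : ℤ)]}.Infinite)) := by
  
  have hsum : ∀ d : ℕ → ℤ,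
      (∀ N : ℕ, 1 ≤ N →
        d N - d (N - 1) = ∑ i ∈ Finset.range (t + 1), l i * b (k ((N : ℤ) - (i : ℤ)))) →
      ∀ N : ℕ, d (N + 1) - d N = ∑ j ∈ Finset.range (u + 1), r j * b (((N + 1 : ℕ) : ℤ) - (j : ℤ)) := by
    intro d hd N
    have h1 := hd (N + 1) (by omega)
    rw [Nat.add_sub_cancel] at h1
    rw [h1]
    exact hrec _ (by push_cast; omega)
  have hkge : ∀ m : ℕ, (m : ℤ) ≤ k m := by
    intro m
    induction m with
    | zero => simp [hk0]
    | succ m ih =>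
      have := hkmono (show (m : ℤ) < (m : ℤ) + 1 by omega)
      push_cast
      omega
  have hex : ∀ n : ℕ, ∃ m : ℕ, k (m : ℤ) ≤ n ∧ (n : ℤ) < k ((m : ℤ) + 1) := by
    intro n
    induction n with
    | zero =>
      refine ⟨0, by simp [hk0], ?_⟩
      have := hkmono (show (0 : ℤ) < 0 + 1 by omega)
      rw [hk0] at this
      simpa using this
    | succ n ih =>
      obtain ⟨m, h1, h2⟩ := ih
      by_cases hc : ((n + 1 : ℕ) : ℤ) < k ((m : ℤ) + 1)
      · exact ⟨m, by push_cast; omega, hc⟩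
      · refine ⟨m + 1, ?_, ?_⟩
        · push_cast at hc ⊢
          omega
        · have := hkmono (show (m : ℤ) + 1 < (m : ℤ) + 1 + 1 by omega)
          push_cast at hc ⊢
          omega
  refine ⟨?_, fun H => H.2.2 H.1, ?_⟩
  · by_cases c1 : ∃ N : ℕ, ∀ n : ℕ, N ≤ n → (h : ℤ) ∣ b (n : ℤ)
    · exact Or.inl c1
    by_cases c2 : ∃ N : ℕ, ∀ n : ℕ, N ≤ n → 1 < Int.gcd (b (n : ℤ)) (h : ℤ)
    · exact Or.inr (Or.inl ⟨c2, c1⟩)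
    refine Or.inr (Or.inr ?_)
    intro d hd c
    obtain ⟨N0, hN0⟩ := hgap
    push Not at c2
    refine Set.infinite_of_forall_exists_gt fun a => ?_
    obtain ⟨n, hn, hg⟩ := c2 (k ((N0 + a + 2 : ℕ) : ℤ)).toNat
    obtain ⟨m, hm1, hm2⟩ := hex n
    have hM : ((N0 + a + 2 : ℕ) : ℤ) < (m : ℤ) + 1 := by
      rw [← hkmono.lt_iff_lt]
      omega
    have hmge := hkge m
    have hgm := hN0 m (by omega)
    have hbn := hflat m n hm1 hm2
    have hcopb : IsCoprime (h : ℤ) (b (k m)) := by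
      rw [← hbn, isCoprime_comm, Int.isCoprime_iff_gcd_eq_one]
      have : 0 < Int.gcd (b (n : ℤ)) (h : ℤ) := Int.gcd_pos_of_ne_zero_right _ (by omega)
      omega
    obtain ⟨x, y, hxy⟩ := hcop.mul_right hcopb
    set ρ := (∑ j ∈ Finset.range (u + 1), r j) * b (k m) with hρ
    obtain ⟨s, hs⟩ : ∃ s : ℕ, (s : ℤ) = k m + u - 1 := ⟨(k m + u - 1).toNat, by omega⟩
    have hprog : ∀ i : ℕ, i < h → d (s + i) = d s + i * ρ := by
      intro i
      induction i with
      | zero => simp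
      | succ i ih =>
        intro hi
        have h1 := hsum d hd (s + i)
        have h2 : ∑ j ∈ Finset.range (u + 1), r j * b (((s + i + 1 : ℕ) : ℤ) - (j : ℤ)) = ρ := by
          rw [hρ, Finset.sum_mul]
          refine Finset.sum_congr rfl fun j hj => ?_
          have hj' := Finset.mem_range.mp hj
          rw [hflat m _ (by push_cast; omega) (by push_cast; omega)]
        rw [h2, ih (by omega)] at h1
        rw [← add_assoc]
        push_cast
        linarith
    have hpos := Int.emod_nonneg ((c - d s) * y) (show (h : ℤ) ≠ 0 by omega)
    have hlt := Int.emod_lt_of_pos ((c - d s) * y) (show (0 : ℤ) < h by omega)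
    obtain ⟨i, hi⟩ : ∃ i : ℕ, (i : ℤ) = ((c - d s) * y) % h := ⟨_, Int.toNat_of_nonneg hpos⟩
    refine ⟨s + i, ?_, by omega⟩
    change d (s + i) ≡ c [ZMOD (h : ℤ)]
    rw [hprog i (by omega), hi]
    have e1 : ((c - d s) * y) % h ≡ (c - d s) * y [ZMOD (h : ℤ)] := Int.mod_modEq _ _
    refine ((e1.mul_right ρ).add_left (d s)).trans ?_
    refine Int.modEq_iff_dvd.mpr ⟨(c - d s) * x, ?_⟩
    linear_combination (-(c - d s)) * hxy
  · rintro ⟨⟨N1, hN1⟩, H⟩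
    let d : ℕ → ℤ := fun N => ∑ q ∈ Finset.range N,
      ∑ i ∈ Finset.range (t + 1), l i * b (k (((q + 1 : ℕ) : ℤ) - (i : ℤ)))
    have hd : ∀ N : ℕ, 1 ≤ N →
        d N - d (N - 1) = ∑ i ∈ Finset.range (t + 1), l i * b (k ((N : ℤ) - (i : ℤ))) := by
      intro N hN
      obtain ⟨M, rfl⟩ : ∃ M, N = M + 1 := ⟨N - 1, by omega⟩
      simp only [d, Nat.add_sub_cancel, Finset.sum_range_succ _ M, add_sub_cancel_left]
    have hconst : ∀ i : ℕ, d (N1 + u + i) ≡ d (N1 + u) [ZMOD (h : ℤ)] := by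
      intro i
      induction i with
      | zero => exact Int.ModEq.refl _
      | succ i ih =>
        refine Int.ModEq.trans ?_ ih
        refine (Int.modEq_iff_dvd.mpr ?_).symm
        rw [← add_assoc, hsum d hd]
        refine Finset.dvd_sum fun j hj => Dvd.dvd.mul_left ?_ _
        have hj' := Finset.mem_range.mp hj
        have h3 := hN1 (N1 + u + i + 1 - j) (by omega)
        rwa [Nat.cast_sub (by omega)] at h3
    refine H d hd (d (N1 + u) + 1) ((Set.finite_lt_nat (N1 + u)).subset ?_)
    intro N hN
    by_contra hlt
    have hge : N1 + u ≤ N := not_lt.mp hlt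
    obtain ⟨i, rfl⟩ := Nat.exists_eq_add_of_le hge
    have h4 := ((hconst i).symm.trans hN)
    have h5 := Int.modEq_iff_dvd.mp h4
    rw [add_sub_cancel_left] at h5
    have := Int.le_of_dvd one_pos h5
    omega
end

section
/- Let T = (K,(1,−1),R) (so L = (1,−1)) and let b be a b_T-sequence. Let p be a prime with p ≥ 3 and p ∤ r, and suppose that there exist infinitely many n with k_{n+1} − k_n ≥ p + u − 1. Then the congruence b(n) ≡ 0 (mod p) has infinitely many solutions n ∈ ℕ. -/
/-- Theorem 2 (TwL) of the paper. -/
theorem stmt_1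
    (k b : ℤ → ℤ) (u : ℕ) (r : ℕ → ℤ)
    (hk0 : k 0 = 0) (hkmono : StrictMono k)
    (hkneg : ∀ z : ℤ, z < 0 → k z = z)
    (hbneg : ∀ z : ℤ, z < 0 → b z = 0)
    (hflat : ∀ n : ℕ, ∀ j : ℤ, k (n : ℤ) ≤ j → j < k ((n : ℤ) + 1) → b j = b (k (n : ℤ)))
    (hrec : ∀ n : ℤ, 1 ≤ n →
      b (k n) - b (k (n - 1)) = ∑ j ∈ Finset.range (u + 1), r j * b (n - (j : ℤ)))
    (p : ℕ) (hp : p.Prime) (hp3 : 3 ≤ p)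
    (hpr : ¬ (p : ℤ) ∣ ∑ j ∈ Finset.range (u + 1), r j)
    (hgap : {n : ℕ | (p : ℤ) + (u : ℤ) - 1 ≤ k ((n : ℤ) + 1) - k (n : ℤ)}.Infinite) :
    {n : ℕ | (p : ℤ) ∣ b (n : ℤ)}.Infinite := by
  have hkge : ∀ n : ℕ, (n : ℤ) ≤ k (n : ℤ) := by
    intro n
    induction n with
    | zero => simp [hk0]
    | succ m ih =>
      have h := hkmono (show (m : ℤ) < ((m + 1 : ℕ) : ℤ) by push_cast; omega)
      push_cast at h ⊢
      omega
  haveI : Fact p.Prime := ⟨hp⟩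
  apply Set.infinite_of_forall_exists_gt
  intro N
  obtain ⟨n, hn, hNn⟩ := hgap.exists_gt (N + 1)
  simp only [Set.mem_setOf_eq] at hn
  have hkn := hkge n
  by_cases hc : (p : ℤ) ∣ b (k n)
  · refine ⟨(k n).toNat, ?_, by omega⟩
    have : (((k n).toNat : ℕ) : ℤ) = k n := Int.toNat_of_nonneg (by omega)
    simp only [Set.mem_setOf_eq, this]
    exact hc
  have claim : ∀ i : ℕ, i < p → b (k (k n + u - 1 + i)) = b (k (k n + u - 1)) +
      i * ((∑ j ∈ Finset.range (u + 1), r j) * b (k n)) := by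
    intro i
    induction i with
    | zero => intro _; simp
    | succ m ih =>
      intro hm
      have h1 := ih (by omega)
      have h2 := hrec (k n + u + m) (by omega)
      have h3 : ∑ j ∈ Finset.range (u + 1), r j * b (k n + u + m - (j : ℤ)) =
          (∑ j ∈ Finset.range (u + 1), r j) * b (k n) := by
        rw [Finset.sum_mul]
        apply Finset.sum_congr rfl
        intro j hj
        rw [Finset.mem_range] at hj
        rw [hflat n (k n + u + m - (j : ℤ)) (by omega) (by omega)]
      rw [h3] at h2
      rw [show k n + u + m - 1 = k n + u - 1 + m by ring, h1] at h2
      rw [show k n + u - 1 + ((m + 1 : ℕ) : ℤ) = k n + u + m by push_cast; ring]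
      push_cast
      linarith
  have hd : (((∑ j ∈ Finset.range (u + 1), r j) * b (k n) : ℤ) : ZMod p) ≠ 0 := by
    rw [Ne, ZMod.intCast_zmod_eq_zero_iff_dvd]
    intro h
    rcases (Nat.prime_iff_prime_int.mp hp).dvd_or_dvd h with h | h
    · exact hpr h
    · exact hc h
  generalize (∑ j ∈ Finset.range (u + 1), r j) * b (k n) = d at claim hd
  obtain ⟨i, hi, hdvd⟩ : ∃ i : ℕ, i < p ∧ (p : ℤ) ∣ b (k (k n + u - 1)) + i * d := by
    refine ⟨(-(b (k (k n + u - 1)) : ZMod p) / (d : ZMod p)).val, ZMod.val_lt _, ?_⟩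
    rw [← ZMod.intCast_zmod_eq_zero_iff_dvd]
    push_cast
    rw [ZMod.natCast_zmod_val, div_mul_cancel₀ _ hd]
    ring
  rw [← claim i hi] at hdvd
  obtain ⟨M, hM⟩ := Int.eq_ofNat_of_zero_le (show 0 ≤ k n + u - 1 + i by omega)
  have hkM := hkge M
  rw [hM] at hdvd
  refine ⟨(k M).toNat, ?_, by omega⟩
  have : (((k M).toNat : ℕ) : ℤ) = k M := Int.toNat_of_nonneg (by omega)
  simp only [Set.mem_setOf_eq, this]
  exact hdvd
end

section
/- Let T = (K,(1,−1),R) and let b be a b_T-sequence, and assume 3 ∤ r. If n is such that k_{n+1} − k_n ≥ u + 2, then at least one of the four numbers b(k_n), b(k_{k_n+u−1}), b(k_{k_n+u}), b(k_{k_n+u+1}) is divisible by 3. -/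
/-- Theorem 4 (Twp3) of the paper. -/
theorem stmt_3
    (k b : ℤ → ℤ) (u : ℕ) (r : ℕ → ℤ)
    (hk0 : k 0 = 0) (hkmono : StrictMono k)
    (hkneg : ∀ z : ℤ, z < 0 → k z = z)
    (hbneg : ∀ z : ℤ, z < 0 → b z = 0)
    (hflat : ∀ n : ℕ, ∀ j : ℤ, k (n : ℤ) ≤ j → j < k ((n : ℤ) + 1) → b j = b (k (n : ℤ)))
    (hrec : ∀ n : ℤ, 1 ≤ n →
      b (k n) - b (k (n - 1)) = ∑ j ∈ Finset.range (u + 1), r j * b (n - (j : ℤ)))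
    (hr3 : ¬ (3 : ℤ) ∣ ∑ j ∈ Finset.range (u + 1), r j)
    (n : ℕ) (hgapn : (u : ℤ) + 2 ≤ k ((n : ℤ) + 1) - k (n : ℤ)) :
    (3 : ℤ) ∣ b (k (n : ℤ)) ∨
    (3 : ℤ) ∣ b (k (k (n : ℤ) + (u : ℤ) - 1)) ∨
    (3 : ℤ) ∣ b (k (k (n : ℤ) + (u : ℤ))) ∨
    (3 : ℤ) ∣ b (k (k (n : ℤ) + (u : ℤ) + 1)) := by
  have hkn : 0 ≤ k (n : ℤ) := by
    rw [← hk0]; exact hkmono.monotone (by positivity)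
  have key : ∀ m : ℤ, 1 ≤ m → k (n : ℤ) + u ≤ m → m ≤ k (n : ℤ) + u + 1 →
      b (k m) - b (k (m - 1)) = (∑ j ∈ Finset.range (u + 1), r j) * b (k (n : ℤ)) := by
    intro m hm h1 h2
    rw [hrec m hm, Finset.sum_mul]
    refine Finset.sum_congr rfl fun j hj => ?_
    have hj' := Finset.mem_range.mp hj
    rw [hflat n (m - j) (by omega) (by omega)]
  by_cases h0 : k (n : ℤ) + u = 0
  · right; left
    rw [h0, hkneg _ (by norm_num), hbneg _ (by norm_num)]
    exact dvd_zero _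
  have e1 := key (k (n : ℤ) + u) (by omega) le_rfl (by omega)
  have e2 := key (k (n : ℤ) + u + 1) (by omega) (by omega) le_rfl
  rw [add_sub_cancel_right] at e2
  by_cases hc : (3 : ℤ) ∣ b (k (n : ℤ))
  · exact Or.inl hc
  have hd : ¬ (3 : ℤ) ∣ (∑ j ∈ Finset.range (u + 1), r j) * b (k (n : ℤ)) := by
    intro h
    rcases Int.prime_three.dvd_or_dvd h with h | h
    · exact hr3 h
    · exact hc h
  generalize (∑ j ∈ Finset.range (u + 1), r j) * b (k (n : ℤ)) = d at e1 e2 hd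
  right
  generalize b (k (k (n : ℤ) + u - 1)) = x at *
  generalize b (k (k (n : ℤ) + u)) = y at *
  generalize b (k (k (n : ℤ) + u + 1)) = z at *
  clear hrec hr3 key hflat
  have hx : x % 3 = 0 ∨ x % 3 = 1 ∨ x % 3 = 2 := by omega
  have hd3 : d % 3 = 1 ∨ d % 3 = 2 := by omega
  rcases hx with h | h | h <;> rcases hd3 with h' | h' <;> omega
end

section
/- For every natural number h such that either 3 ≤ h ≤ 41 and 8 ∤ h, or h ∈ {44, 52, 60, 68, 76}, there exist infinitely many n ∈ ℕ such that b_2(n) is divisible by h. -/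
/-- The number of `m`-ary partitions of `n`, i.e. the number of representations
`n = ∑ i, f i * m ^ i` with finitely supported `f : ℕ → ℕ`. -/
noncomputable def mAryPartitions (m n : ℕ) : ℕ :=
  Nat.card {f : ℕ →₀ ℕ // (f.sum fun i c => c * m ^ i) = n}

namespace BP

/-- pack a list of digits in base `B` -/
def pkl (B : ℕ) (L : List ℕ) : ℕ :=
  List.rec 0 (fun x _ ih => Nat.add x (Nat.mul B ih)) L

/-- pack the digits `f 0, f 1, …, f (n-1)` in base `B` -/
def pk (B : ℕ) (f : ℕ → ℕ) (n : ℕ) : ℕ → ℕ :=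
  Nat.rec (fun _ => 0) (fun _ ih t => Nat.add (f t) (Nat.mul B (ih (Nat.succ t)))) n

def size (k : ℕ) : ℕ := 2 ^ (k + 1) - 1

/-- prefix sums modulo `h` of the doubled list -/
def expand (h : ℕ) (w : List ℕ) : ℕ → List ℕ :=
  List.rec (fun c => [c])
    (fun x _ ih c => c :: (Nat.mod (Nat.add c x) h) :: ih (Nat.mod (Nat.add c (Nat.add x x)) h)) w

def ptab (h : ℕ) (l : ℕ) (i : ℕ) : List ℕ :=
  Nat.rec (fun l => List.replicate (size l) 1) (fun _ ih l => expand h (ih (l - 1)) 0) i l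

/-- width of the small fields at level `l` -/
def wd (l : ℕ) : ℕ := Nat.add (Nat.sub l 7) 9
/-- base of the big fields at level `l` -/
def bs (h l : ℕ) : ℕ := Nat.pow 2 (Nat.add (Nat.mul (wd l) h) 20)
/-- fixed point approximation of `1 / h` -/
def gg (h : ℕ) : ℕ := Nat.succ (Nat.div 1048576 h)

def P (h l i : ℕ) : ℕ := Nat.mul (gg h) (pkl (bs h l) (ptab h l i))

/-- parity of the 2-adic valuation being odd -/
def oddVal (fuel : ℕ) : ℕ → Bool :=
  Nat.rec (fun _ => false) (fun _ ih m =>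
    cond (Nat.beq (Nat.mod m 2) 1) false (cond (Nat.beq (Nat.mod m 4) 2) true (ih (Nat.div m 4)))) fuel

def valid (four : Bool) (k t : ℕ) : Bool :=
  cond four (cond (Nat.beq (Nat.succ t) (Nat.pow 2 k)) false (oddVal 12 (Nat.succ t))) true

def bnat (b : Bool) : ℕ := cond b 1 0

def rep (h l : ℕ) (v : ℕ) : ℕ := pk (Nat.pow 2 (wd l)) (fun _ => v) h 0
def m1 (h l : ℕ) : ℕ := pk (bs h l) (fun _ => 1040384) (size l) 0
def r1 (h l : ℕ) : ℕ := rep h l 1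
def cAdd (h l : ℕ) : ℕ :=
  pk (bs h l) (fun _ => Nat.mul 8192 (pk (Nat.pow 2 (wd l))
    (fun c => Nat.sub 128 (Nat.div (Nat.mul c (gg h)) 8192)) h 0)) (size l) 0
def m2 (four : Bool) (h l : ℕ) : ℕ :=
  pk (bs h l) (fun t => cond (valid four l t) (Nat.mul 8192 (rep h l 128)) 0) (size l) 0
def b1 (h l : ℕ) : ℕ := Nat.sub (bs h l) 1
def r2 (h l : ℕ) : ℕ := rep h l (Nat.pow 2 (Nat.sub (wd l) 1))

def fin (h l N : ℕ) : ℕ :=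
  Nat.land (Nat.sub (r2 h l) (Nat.sub N (Nat.shiftRight N (wd l)))) (r2 h l)

def test (four : Bool) (h l F : ℕ) : ℕ :=
  fin h l (Nat.shiftRight (Nat.mod (Nat.land (Nat.add (Nat.mul (Nat.land F (m1 h l)) (r1 h l)) (cAdd h l)) (m2 four h l)) (b1 h l)) 20)

def idx (h l : ℕ) : ℕ := pk (Nat.pow 2 (wd l)) (fun c => Nat.sub h c) (Nat.succ h) 0

def sh (h l : ℕ) : ℕ := Nat.sub (Nat.mul (wd l) (Nat.succ h)) 1

/-- index of the lowest set bit -/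
def lowIdx (h l S : ℕ) : ℕ :=
  Nat.land (Nat.shiftRight (Nat.mul (Nat.sub S (Nat.land S (Nat.sub S 1))) (idx h l)) (sh h l)) 127

def loop (h l : ℕ) (child : ℕ → Bool) (fuel : ℕ) : ℕ → Bool :=
  Nat.rec (fun S => Nat.beq S 0) (fun _ ih S =>
    Nat.rec true (fun _ _ =>
      (fun c => Bool.rec false (ih (Nat.xor S (Nat.pow 2 (Nat.sub (Nat.mul (wd l) (Nat.succ c)) 1)))) (child (Nat.sub h c)))
        (lowIdx h l S)) S) fuel

def n9 (four : Bool) (h F9 : ℕ) : Bool := Nat.beq (test four h 9 F9) 0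
def n8 (four : Bool) (h F8 F9 : ℕ) : Bool :=
  loop h 8 (fun z => n9 four h
    (Nat.add F9 (Nat.mul z (P h 9 1))))
    h (test four h 8 F8)
def n7 (four : Bool) (h F7 F8 F9 : ℕ) : Bool :=
  loop h 7 (fun z => n8 four h
    (Nat.add F8 (Nat.mul z (P h 8 1)))
    (Nat.add F9 (Nat.mul z (P h 9 2))))
    h (test four h 7 F7)
def n6 (four : Bool) (h F6 F7 F8 F9 : ℕ) : Bool :=
  loop h 6 (fun z => n7 four h
    (Nat.add F7 (Nat.mul z (P h 7 1)))
    (Nat.add F8 (Nat.mul z (P h 8 2)))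
    (Nat.add F9 (Nat.mul z (P h 9 3))))
    h (test four h 6 F6)
def n5 (four : Bool) (h F5 F6 F7 F8 F9 : ℕ) : Bool :=
  loop h 5 (fun z => n6 four h
    (Nat.add F6 (Nat.mul z (P h 6 1)))
    (Nat.add F7 (Nat.mul z (P h 7 2)))
    (Nat.add F8 (Nat.mul z (P h 8 3)))
    (Nat.add F9 (Nat.mul z (P h 9 4))))
    h (test four h 5 F5)
def n4 (four : Bool) (h F4 F5 F6 F7 F8 F9 : ℕ) : Bool :=
  loop h 4 (fun z => n5 four h
    (Nat.add F5 (Nat.mul z (P h 5 1)))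
    (Nat.add F6 (Nat.mul z (P h 6 2)))
    (Nat.add F7 (Nat.mul z (P h 7 3)))
    (Nat.add F8 (Nat.mul z (P h 8 4)))
    (Nat.add F9 (Nat.mul z (P h 9 5))))
    h (test four h 4 F4)
def n3 (four : Bool) (h F3 F4 F5 F6 F7 F8 F9 : ℕ) : Bool :=
  loop h 3 (fun z => n4 four h
    (Nat.add F4 (Nat.mul z (P h 4 1)))
    (Nat.add F5 (Nat.mul z (P h 5 2)))
    (Nat.add F6 (Nat.mul z (P h 6 3)))
    (Nat.add F7 (Nat.mul z (P h 7 4)))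
    (Nat.add F8 (Nat.mul z (P h 8 5)))
    (Nat.add F9 (Nat.mul z (P h 9 6))))
    h (test four h 3 F3)

def ini (h y1 y2 l : ℕ) : ℕ := Nat.add (Nat.mul y1 (P h l (l - 1))) (Nat.mul y2 (P h l (l - 2)))
def check (four : Bool) (h y1 y2 : ℕ) : Bool :=
  n3 four h (ini h y1 y2 3) (ini h y1 y2 4) (ini h y1 y2 5) (ini h y1 y2 6) (ini h y1 y2 7) (ini h y1 y2 8) (ini h y1 y2 9)

end BP

namespace BP

theorem pk_zero (B : ℕ) (f : ℕ → ℕ) (t : ℕ) : pk B f 0 t = 0 := rfl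
theorem pk_succ (B : ℕ) (f : ℕ → ℕ) (n t : ℕ) :
    pk B f (n + 1) t = f t + B * pk B f n (t + 1) := rfl

theorem pk_congr {B : ℕ} {f g : ℕ → ℕ} (n t : ℕ) (H : ∀ i, t ≤ i → i < t + n → f i = g i) :
    pk B f n t = pk B g n t := by
  induction n generalizing t with
  | zero => rfl
  | succ n ih =>
    rw [pk_succ, pk_succ, H t le_rfl (by omega), ih (t + 1) (fun i h1 h2 => H i (by omega) (by omega))]

theorem pk_mul (B a : ℕ) (f : ℕ → ℕ) (n t : ℕ) :
    a * pk B f n t = pk B (fun i => a * f i) n t := by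
  induction n generalizing t with
  | zero => rfl
  | succ n ih => rw [pk_succ, pk_succ, ← ih]; ring

theorem pk_add (B : ℕ) (f g : ℕ → ℕ) (n t : ℕ) :
    pk B f n t + pk B g n t = pk B (fun i => f i + g i) n t := by
  induction n generalizing t with
  | zero => rfl
  | succ n ih => rw [pk_succ, pk_succ, pk_succ, ← ih]; ring

theorem pk_sub (B : ℕ) (f g : ℕ → ℕ) (n t : ℕ) (H : ∀ i, t ≤ i → i < t + n → g i ≤ f i) :
    pk B f n t - pk B g n t = pk B (fun i => f i - g i) n t := by
  have : pk B f n t = pk B g n t + pk B (fun i => f i - g i) n t := by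
    rw [pk_add]
    exact pk_congr n t (fun i h1 h2 => by have := H i h1 h2; omega)
  omega

theorem pk_lt {B : ℕ} {f : ℕ → ℕ} (n t : ℕ) (H : ∀ i, t ≤ i → i < t + n → f i < B) :
    pk B f n t < B ^ n := by
  induction n generalizing t with
  | zero => simp [pk_zero]
  | succ n ih =>
    have h1 := ih (t + 1) (fun i h1 h2 => H i (by omega) (by omega))
    have h2 := H t le_rfl (by omega)
    rw [pk_succ, pow_succ]
    nlinarith

theorem land_split (w a b x y : ℕ) (ha : a < 2 ^ w) (hb : b < 2 ^ w) :
    (a + 2 ^ w * x) &&& (b + 2 ^ w * y) = (a &&& b) + 2 ^ w * (x &&& y) := by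
  have hab : a &&& b < 2 ^ w := Nat.and_lt_two_pow _ hb
  apply Nat.eq_of_testBit_eq
  intro i
  rw [Nat.testBit_and, add_comm a, add_comm b, add_comm (a &&& b), Nat.testBit_two_pow_mul_add _ ha,
    Nat.testBit_two_pow_mul_add _ hb, Nat.testBit_two_pow_mul_add _ hab]
  split <;> rw [Nat.testBit_and]

theorem pk_land (w : ℕ) (f g : ℕ → ℕ) (n t : ℕ) (hf : ∀ i, t ≤ i → i < t + n → f i < 2 ^ w)
    (hg : ∀ i, t ≤ i → i < t + n → g i < 2 ^ w) :
    pk (2 ^ w) f n t &&& pk (2 ^ w) g n t = pk (2 ^ w) (fun i => f i &&& g i) n t := by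
  induction n generalizing t with
  | zero => simp [pk_zero]
  | succ n ih =>
    rw [pk_succ, pk_succ, pk_succ, land_split w _ _ _ _ (hf t le_rfl (by omega)) (hg t le_rfl (by omega)),
      ih (t + 1) (fun i h1 h2 => hf i (by omega) (by omega)) (fun i h1 h2 => hg i (by omega) (by omega))]

theorem pk_testBit (w : ℕ) (f : ℕ → ℕ) (n t c j : ℕ) (hf : ∀ i, t ≤ i → i < t + n → f i < 2 ^ w)
    (hc : c < n) (hj : j < w) :
    (pk (2 ^ w) f n t).testBit (w * c + j) = (f (t + c)).testBit j := by
  induction n generalizing t c with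
  | zero => omega
  | succ n ih =>
    rw [pk_succ, add_comm, Nat.testBit_two_pow_mul_add _ (hf t le_rfl (by omega))]
    rcases c with _ | c
    · simp [hj]
    · rw [if_neg (by rw [Nat.mul_succ]; omega)]
      have : w * (c + 1) + j - w = w * c + j := by rw [Nat.mul_succ]; omega
      rw [this, ih (t + 1) c (fun i h1 h2 => hf i (by omega) (by omega)) (by omega)]
      congr 2; omega

theorem pk_shift (w : ℕ) (f : ℕ → ℕ) (n t : ℕ) (hf : f t < 2 ^ w) :
    pk (2 ^ w) f (n + 1) t >>> w = pk (2 ^ w) f n (t + 1) := by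
  rw [pk_succ, Nat.shiftRight_eq_div_pow, Nat.add_mul_div_left _ _ (by positivity),
    Nat.div_eq_of_lt hf, zero_add]

theorem pk_step (B : ℕ) (f : ℕ → ℕ) (n t : ℕ) :
    pk B f n (t + 1) = pk B (fun i => f (i + 1)) n t := by
  induction n generalizing t with
  | zero => rfl
  | succ n ih => rw [pk_succ, pk_succ, ih]

theorem pk_last (B : ℕ) (f : ℕ → ℕ) (n t : ℕ) (H : f (t + n) = 0) :
    pk B f (n + 1) t = pk B f n t := by
  induction n generalizing t with
  | zero => simp [pk_succ, pk_zero] at H ⊢; exact H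
  | succ n ih => rw [pk_succ, ih (t + 1) (by rw [← H]; congr 1; omega), ← pk_succ]

theorem pk_mod (B : ℕ) (hB : 1 ≤ B) (f : ℕ → ℕ) (n t : ℕ) :
    pk B f n t ≡ ∑ i ∈ Finset.range n, f (t + i) [MOD B - 1] := by
  induction n generalizing t with
  | zero => rfl
  | succ n ih =>
    rw [pk_succ, Finset.sum_range_succ', add_comm]
    apply Nat.ModEq.add _ rfl
    have h1 : B ≡ 1 [MOD B - 1] := by
      exact ((Nat.modEq_iff_dvd' hB).2 (dvd_refl _)).symm
    have h2 := h1.mul (ih (t + 1))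
    rw [one_mul] at h2
    have h3 : ∑ i ∈ Finset.range n, f (t + (i + 1)) = ∑ i ∈ Finset.range n, f (t + 1 + i) :=
      Finset.sum_congr rfl (fun i _ => by congr 1; omega)
    rw [h3]; exact h2

theorem pk_sum (B : ℕ) (f : ℕ → ℕ → ℕ) (s : Finset ℕ) (n t : ℕ) :
    ∑ i ∈ s, pk B (f i) n t = pk B (fun c => ∑ i ∈ s, f i c) n t := by
  induction n generalizing t with
  | zero => simp [pk_zero]
  | succ n ih => simp only [pk_succ, Finset.sum_add_distrib, ← Finset.mul_sum, ih]

/-- numerical side conditions on `h` -/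
structure Ok (h : ℕ) : Prop where
  h7 : 7 ≤ h
  h41 : h ≤ 41
  hg : 8192 + 9 * h * (h * gg h - 1048576) < gg h

theorem gg_eq (h : ℕ) : gg h = 1048576 / h + 1 := rfl
theorem wd_eq (l : ℕ) : wd l = l - 7 + 9 := rfl
theorem bs_eq (h l : ℕ) : bs h l = 2 ^ (wd l * h + 20) := rfl

theorem Ok.mul_gg {h : ℕ} (H : Ok h) : 1048576 ≤ h * gg h := by
  have := H.h7
  have h1 := Nat.div_add_mod 1048576 h
  have h2 := Nat.mod_lt 1048576 (show 0 < h by omega)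
  rw [gg_eq]; nlinarith

theorem Ok.gg_lt {h : ℕ} (H : Ok h) : gg h < 2 ^ 19 := by
  have := H.h7
  have : 1048576 / h ≤ 1048576 / 7 := Nat.div_le_div_left H.h7 (by norm_num)
  rw [gg_eq]; omega

/-- threshold code -/
def uc (h c : ℕ) : ℕ := c * gg h / 8192

theorem uc_mono (h : ℕ) : Monotone (uc h) := fun _ _ hab =>
  Nat.div_le_div_right (Nat.mul_le_mul_right _ hab)

theorem uc_lt {h c : ℕ} (H : Ok h) (hc : c < h) : uc h c < 128 := by
  have h1 := H.mul_gg
  have h2 : c * gg h ≤ (h - 1) * gg h := Nat.mul_le_mul_right _ (by omega)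
  have h3 : (h - 1) * gg h + gg h = h * gg h := by
    rw [← Nat.succ_mul]; congr 1; have := H.h7; omega
  have h4 := H.hg
  have : 1 * (h * gg h - 1048576) ≤ 9 * h * (h * gg h - 1048576) :=
    Nat.mul_le_mul_right _ (by have := H.h7; omega)
  unfold uc
  rw [Nat.div_lt_iff_lt_mul (by norm_num)]
  omega

/-- code of a value -/
def cd (h φ : ℕ) : ℕ := gg h * φ / 8192 % 128

theorem cd_eq {h φ : ℕ} (H : Ok h) (hφ : φ ≤ 9 * h * h) :
    cd h φ = ((φ / h) * (h * gg h - 1048576) + (φ % h) * gg h) / 8192 ∧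
    (φ / h) * (h * gg h - 1048576) + 8192 < gg h := by
  have h7 := H.h7
  have h1 := H.mul_gg
  obtain ⟨e, he⟩ : ∃ e, e = h * gg h - 1048576 := ⟨_, rfl⟩
  have hq : φ / h ≤ 9 * h := Nat.div_le_of_le_mul (by linarith)
  have hg := H.hg
  have hqe : (φ / h) * e ≤ 9 * h * e := Nat.mul_le_mul_right _ hq
  rw [← he] at hg ⊢
  refine ⟨?_, by omega⟩
  have hr : φ % h ≤ h - 1 := by have := Nat.mod_lt φ (show 0 < h by omega); omega
  have h3 : (h - 1) * gg h + gg h = h * gg h := by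
    rw [← Nat.succ_mul]; congr 1; have := H.h7; omega
  have h4 : (φ % h) * gg h ≤ (h - 1) * gg h := Nat.mul_le_mul_right _ hr
  have h5 : 1 * e ≤ 9 * h * e := Nat.mul_le_mul_right _ (by omega)
  have h6 : gg h * φ = ((φ / h) * e + (φ % h) * gg h) + 1048576 * (φ / h) := by
    have := Nat.div_add_mod φ h
    have h8 : h * gg h = e + 1048576 := by omega
    calc gg h * φ = gg h * (h * (φ / h) + φ % h) := by rw [this]
      _ = (h * gg h) * (φ / h) + (φ % h) * gg h := by ring
      _ = _ := by rw [h8]; ring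
  unfold cd
  rw [h6]
  have h9 : φ / h * e + φ % h * gg h < 1048576 := by
    have h10 : h * gg h ≤ 1048576 + h := by
      rw [gg_eq, mul_add, mul_one]
      have := Nat.mul_div_le 1048576 h
      omega
    have := H.h41
    omega
  omega

theorem cd_sep {h φ c : ℕ} (H : Ok h) (hφ : φ ≤ 9 * h * h) (hc : φ % h ≠ c) :
    (uc h c ≤ cd h φ ↔ uc h (c + 1) ≤ cd h φ) := by
  obtain ⟨h1, h2⟩ := cd_eq H hφ
  rw [h1]
  set x := φ / h * (h * gg h - 1048576)
  rcases lt_or_gt_of_ne hc with h3 | h3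
  · have : (φ % h + 1) * gg h ≤ c * gg h := Nat.mul_le_mul_right _ h3
    have h5 : (x + φ % h * gg h) / 8192 < uc h c := by
      unfold uc
      rw [add_mul] at this
      omega
    have := uc_mono h (Nat.le_succ c)
    simp only [Nat.succ_eq_add_one] at this
    omega
  · have : (c + 1) * gg h ≤ φ % h * gg h := Nat.mul_le_mul_right _ h3
    have h5 : uc h (c + 1) ≤ (x + φ % h * gg h) / 8192 := Nat.div_le_div_right (by omega)
    have := uc_mono h (Nat.le_succ c)
    simp only [Nat.succ_eq_add_one] at this
    omega

/-- nothing has code above the last threshold -/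
theorem cd_top {h φ : ℕ} (H : Ok h) (hφ : φ ≤ 9 * h * h) (hc : φ % h ≠ h - 1) :
    cd h φ < uc h (h - 1) := by
  have h7 := H.h7
  obtain ⟨h1, h2⟩ := cd_eq H hφ
  rw [h1]
  set x := φ / h * (h * gg h - 1048576)
  have hr := Nat.mod_lt φ (show 0 < h by omega)
  have : (φ % h + 1) * gg h ≤ (h - 1) * gg h := Nat.mul_le_mul_right _ (by omega)
  unfold uc
  rw [add_mul] at this
  omega

end BP

namespace BP

theorem land_mask (x : ℕ) : x &&& 1040384 = 8192 * (x / 8192 % 128) := by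
  have h1 : x = x % 2 ^ 13 + 2 ^ 13 * (x / 2 ^ 13) := by omega
  conv_lhs => rw [h1, show 1040384 = 0 + 2 ^ 13 * 127 by norm_num]
  rw [land_split 13 _ _ _ _ (Nat.mod_lt _ (by norm_num)) (by norm_num), Nat.and_zero, zero_add,
    show 127 = 2 ^ 7 - 1 by norm_num, Nat.and_two_pow_sub_one_eq_mod]
  norm_num

theorem land_8192 (x y : ℕ) : (8192 * x) &&& (8192 * y) = 8192 * (x &&& y) := by
  have := land_split 13 0 0 x y (by norm_num) (by norm_num)
  simpa using this

theorem land_128 (x : ℕ) (hx : x < 256) : x &&& 128 = if 128 ≤ x then 128 else 0 := by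
  revert x; decide +kernel

/-- number of valid positions with code at least the `c`-th threshold -/
def cnt (four : Bool) (h l : ℕ) (φ : ℕ → ℕ) (c : ℕ) : ℕ :=
  ∑ t ∈ Finset.range (size l), if valid four l t = true ∧ c < h ∧ uc h c ≤ cd h (φ t) then 1 else 0

theorem size_lt (l : ℕ) (hl : l ≤ 9) : size l < 2 ^ (wd l - 1) := by
  unfold size; rw [wd_eq]
  interval_cases l <;> norm_num

theorem cnt_le (four : Bool) (h l : ℕ) (φ : ℕ → ℕ) (c : ℕ) : cnt four h l φ c ≤ size l := by
  unfold cnt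
  refine (Finset.sum_le_sum (g := fun _ => 1) (fun i _ => by split <;> omega)).trans ?_
  simp

theorem cnt_anti (four : Bool) (h l : ℕ) (φ : ℕ → ℕ) (c : ℕ) :
    cnt four h l φ (c + 1) ≤ cnt four h l φ c := by
  unfold cnt
  refine Finset.sum_le_sum (fun i _ => ?_)
  have := uc_mono h (Nat.le_succ c)
  simp only [Nat.succ_eq_add_one] at this
  split_ifs with h1 h2
  · exact le_rfl
  · exact absurd ⟨h1.1, by omega, by omega⟩ h2
  · omega
  · exact le_rfl

theorem inner_eq {h l x : ℕ} (H : Ok h) (hx : x < 128) :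
    (x * r1 h l + pk (2 ^ wd l) (fun c => 128 - uc h c) h 0) &&& rep h l 128
      = 128 * pk (2 ^ wd l) (fun c => if uc h c ≤ x then 1 else 0) h 0 := by
  have h256 : 256 < 2 ^ wd l :=
    lt_of_lt_of_le (by norm_num : 256 < 2 ^ 9) (Nat.pow_le_pow_right (by norm_num) (by rw [wd_eq]; omega))
  have h1 : x * r1 h l = pk (2 ^ wd l) (fun _ => x * 1) h 0 := pk_mul _ _ _ _ _
  rw [h1, pk_add, show rep h l 128 = pk (2 ^ wd l) (fun _ => 128) h 0 from rfl, pk_land, pk_mul]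
  · refine pk_congr _ _ (fun i _ h2 => ?_)
    have h3 := uc_lt H (show i < h by omega)
    rw [land_128 _ (by omega)]
    split_ifs <;> omega
  · intro i _ _; omega
  · intro i _ _; omega

theorem inner_lt {h l x : ℕ} (hx : x < 128) :
    x * r1 h l + pk (2 ^ wd l) (fun c => 128 - uc h c) h 0 < 2 ^ (wd l * h) := by
  have h256 : 256 < 2 ^ wd l :=
    lt_of_lt_of_le (by norm_num : 256 < 2 ^ 9) (Nat.pow_le_pow_right (by norm_num) (by rw [wd_eq]; omega))
  have h1 : x * r1 h l = pk (2 ^ wd l) (fun _ => x * 1) h 0 := pk_mul _ _ _ _ _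
  rw [h1, pk_add, pow_mul]
  exact pk_lt _ _ (fun i _ _ => by omega)

theorem rep_lt {h l v : ℕ} (hv : v < 2 ^ wd l) : rep h l v < 2 ^ (wd l * h) := by
  rw [pow_mul]; exact pk_lt _ _ (fun i _ _ => hv)

theorem cnt_pack {four : Bool} {h l F : ℕ} {φ : ℕ → ℕ} (H : Ok h) (hl : l ≤ 9)
    (hφ : ∀ t, φ t ≤ 9 * h * h) (hF : F = gg h * pk (bs h l) φ (size l) 0) :
    (((((F &&& m1 h l) * r1 h l + cAdd h l) &&& m2 four h l) % b1 h l) >>> 20)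
      = pk (2 ^ wd l) (cnt four h l φ) h 0 := by
  have h7 := H.h7
  have h41 := H.h41
  obtain ⟨W, hW⟩ : ∃ W, W = wd l * h + 20 := ⟨_, rfl⟩
  have hw9 : 9 ≤ wd l := by rw [wd_eq]; omega
  have hWbig : 2 ^ 40 ≤ 2 ^ W := Nat.pow_le_pow_right (by norm_num) (by nlinarith)
  have hsplit : 2 ^ W = 1048576 * 2 ^ (wd l * h) := by rw [hW, pow_add]; norm_num; ring
  have hb : bs h l = 2 ^ W := by rw [hW]; rfl
  have hcd : ∀ t, cd h (φ t) < 128 := fun t => Nat.mod_lt _ (by norm_num)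
  have e1 : F &&& m1 h l = pk (2 ^ W) (fun t => 8192 * cd h (φ t)) (size l) 0 := by
    rw [hF, pk_mul, hb, show m1 h l = pk (2 ^ W) (fun _ => 1040384) (size l) 0 by rw [← hb]; rfl, pk_land]
    · exact pk_congr _ _ (fun i _ _ => land_mask _)
    · intro i _ _
      refine lt_of_lt_of_le ?_ hWbig
      have h1 := H.gg_lt
      have h2 : φ i ≤ 9 * 41 * 41 := (hφ i).trans (by nlinarith)
      have : gg h * φ i ≤ 2 ^ 19 * (9 * 41 * 41) := Nat.mul_le_mul h1.le h2
      norm_num at this ⊢; omega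
    · intro i _ _; omega
  have e2 : (F &&& m1 h l) * r1 h l + cAdd h l = pk (2 ^ W) (fun t => 8192 *
      (cd h (φ t) * r1 h l + pk (2 ^ wd l) (fun c => 128 - uc h c) h 0)) (size l) 0 := by
    have e3 : cAdd h l = pk (2 ^ W) (fun _ => 8192 * pk (2 ^ wd l) (fun c => 128 - uc h c) h 0)
      (size l) 0 := by rw [← hb]; rfl
    rw [e1, mul_comm _ (r1 h l), pk_mul, e3, pk_add]
    exact pk_congr _ _ (fun i _ _ => by ring)
  have e4 : ((F &&& m1 h l) * r1 h l + cAdd h l) &&& m2 four h l = pk (2 ^ W)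
      (fun t => 1048576 * pk (2 ^ wd l) (fun c =>
        if valid four l t = true ∧ c < h ∧ uc h c ≤ cd h (φ t) then 1 else 0) h 0) (size l) 0 := by
    have e5 : m2 four h l = pk (2 ^ W) (fun t => cond (valid four l t) (8192 * rep h l 128) 0)
      (size l) 0 := by rw [← hb]; rfl
    rw [e2, e5, pk_land]
    · refine pk_congr _ _ (fun t _ _ => ?_)
      cases hv : valid four l t
      · simp only [cond_false, Nat.and_zero]
        rw [pk_congr (g := fun _ => 0 * 0) _ _ (fun i _ _ => by simp), ← pk_mul]; simp
      · simp only [cond_true]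
        rw [land_8192, inner_eq H (hcd t), ← mul_assoc]
        rw [show 8192 * 128 = 1048576 by norm_num]
        have e8 : pk (2 ^ wd l) (fun c => if uc h c ≤ cd h (φ t) then 1 else 0) h 0 =
            pk (2 ^ wd l) (fun c => if True ∧ c < h ∧ uc h c ≤ cd h (φ t) then 1 else 0) h 0 :=
          pk_congr h 0 (fun i _ hi => by simp [show i < h by omega])
        rw [e8]
    · intro t _ _
      have := inner_lt (h := h) (l := l) (hcd t)
      omega
    · intro t _ _
      have : rep h l 128 < 2 ^ (wd l * h) := rep_lt
        (lt_of_lt_of_le (by norm_num : 128 < 2 ^ 9) (Nat.pow_le_pow_right (by norm_num) hw9))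
      cases valid four l t
      · simp
      · simp only [cond_true]; omega
  have hcl : ∀ c, cnt four h l φ c < 2 ^ wd l - 1 := by
    intro c
    have h1 := cnt_le four h l φ c
    have h2 := size_lt l hl
    have h3 : 2 ^ wd l = 2 * 2 ^ (wd l - 1) := by
      have h4 := pow_succ' 2 (wd l - 1)
      rwa [Nat.sub_add_cancel (by omega)] at h4
    omega
  have hN : pk (2 ^ wd l) (cnt four h l φ) h 0 < 2 ^ (wd l * h) := by
    rw [pow_mul]; exact pk_lt _ _ (fun i _ _ => by have := hcl i; omega)
  have e6 := pk_mod (2 ^ W) Nat.one_le_two_pow (fun t => 1048576 * pk (2 ^ wd l) (fun c =>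
        if valid four l t = true ∧ c < h ∧ uc h c ≤ cd h (φ t) then 1 else 0) h 0) (size l) 0
  have hb1 : b1 h l = 2 ^ W - 1 := by rw [← hb]; rfl
  rw [← e4, ← Finset.mul_sum] at e6
  simp only [zero_add] at e6
  rw [pk_sum, ← hb1] at e6
  have e7 : ((F &&& m1 h l) * r1 h l + cAdd h l &&& m2 four h l) % b1 h l =
    (1048576 * pk (2 ^ wd l) (cnt four h l φ) h 0) % b1 h l := e6
  rw [e7, Nat.mod_eq_of_lt (by rw [hb1]; omega), Nat.shiftRight_eq_div_pow, show 2 ^ 20 = 1048576 by norm_num,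
    Nat.mul_div_cancel_left _ (by norm_num)]

theorem test_sound {four : Bool} {h l F c : ℕ} {φ : ℕ → ℕ} (H : Ok h) (hl : l ≤ 9)
    (hφ : ∀ t, φ t ≤ 9 * h * h) (hF : F = gg h * pk (bs h l) φ (size l) 0) (hc : c < h)
    (hav : ∀ t < size l, valid four l t = true → φ t % h ≠ c) :
    (test four h l F).testBit (wd l * (c + 1) - 1) = true := by
  have h7 := H.h7
  have hw9 : 9 ≤ wd l := by rw [wd_eq]; omega
  have e1 : test four h l F = fin h l (pk (2 ^ wd l) (cnt four h l φ) h 0) := by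
    rw [← cnt_pack H hl hφ hF]; rfl
  have h3 : 2 ^ wd l = 2 * 2 ^ (wd l - 1) := by
    have h4 := pow_succ' 2 (wd l - 1)
    rwa [Nat.sub_add_cancel (by omega)] at h4
  have hcl : ∀ c, cnt four h l φ c < 2 ^ (wd l - 1) := by
    intro c
    have h1 := cnt_le four h l φ c
    have h2 := size_lt l hl
    omega
  have htop : cnt four h l φ h = 0 := by unfold cnt; simp
  have e2 : pk (2 ^ wd l) (cnt four h l φ) h 0 >>> wd l
      = pk (2 ^ wd l) (fun c => cnt four h l φ (c + 1)) h 0 := by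
    conv_lhs => rw [← pk_last (2 ^ wd l) (cnt four h l φ) h 0 (by rw [zero_add]; exact htop)]
    rw [pk_shift _ _ _ _ (by have := hcl 0; omega), pk_step]
  have hr2 : r2 h l = pk (2 ^ wd l) (fun _ => 2 ^ (wd l - 1)) h 0 := rfl
  have e3 : fin h l (pk (2 ^ wd l) (cnt four h l φ) h 0) =
      pk (2 ^ wd l) (fun c => (2 ^ (wd l - 1) - (cnt four h l φ c - cnt four h l φ (c + 1)))
        &&& 2 ^ (wd l - 1)) h 0 := by
    change (r2 h l - (pk (2 ^ wd l) (cnt four h l φ) h 0 -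
      pk (2 ^ wd l) (cnt four h l φ) h 0 >>> wd l)) &&& r2 h l = _
    have hpos : 0 < 2 ^ (wd l - 1) := by positivity
    rw [e2, hr2, pk_sub _ _ _ _ _ (fun i _ _ => cnt_anti four h l φ i), pk_sub, pk_land]
    · intro i _ _; omega
    · intro i _ _; omega
    · intro i _ _; have := hcl i; omega
  have heq : cnt four h l φ c = cnt four h l φ (c + 1) := by
    unfold cnt
    refine Finset.sum_congr rfl (fun t ht => ?_)
    rw [Finset.mem_range] at ht
    by_cases hv : valid four l t = true
    · have h5 := hav t ht hv
      rcases Nat.lt_or_ge (c + 1) h with h6 | h6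
      · have := cd_sep H (hφ t) h5
        simp [hv, hc, h6, this]
      · have h8 : c = h - 1 := by omega
        have := cd_top H (hφ t) (h8 ▸ h5)
        rw [← h8] at this
        simp [show ¬ c + 1 < h by omega, hc, this]
    · simp [hv]
  have e4 : wd l * (c + 1) - 1 = wd l * c + (wd l - 1) := by rw [Nat.mul_succ]; omega
  have hpos : 0 < 2 ^ (wd l - 1) := by positivity
  rw [e1, e3, e4, pk_testBit _ _ _ _ _ _ _ hc (by omega), zero_add, heq]
  · simp
  · intro i _ _
    exact Nat.and_lt_two_pow _ (by omega)

end BP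

namespace BP

theorem loop_sound (h l : ℕ) (child : ℕ → Bool) (fuel S : ℕ) (H : loop h l child fuel S = true)
    (c : ℕ) (hc : S.testBit (wd l * (c + 1) - 1) = true) : child (h - c) = true := by
  induction fuel generalizing S with
  | zero =>
    have : S = 0 := Nat.eq_of_beq_eq_true H
    subst this
    simp at hc
  | succ fuel ih =>
    rcases S with _ | S
    · simp at hc
    · have H' : Bool.rec false (loop h l child fuel ((S + 1) ^^^ 2 ^ (wd l * (lowIdx h l (S + 1) + 1) - 1)))
        (child (h - lowIdx h l (S + 1))) = true := H
      cases hch : child (h - lowIdx h l (S + 1)) with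
      | false => rw [hch] at H'; exact absurd H' (by simp)
      | true =>
        rw [hch] at H'
        by_cases hcc : c = lowIdx h l (S + 1)
        · rw [hcc]; exact hch
        · refine ih _ H' ?_
          rw [Nat.testBit_xor, hc, Nat.testBit_two_pow_of_ne]
          · rfl
          · have hw9 : 9 ≤ wd l := by rw [wd_eq]; omega
            intro he
            apply hcc
            have h1 : wd l * (lowIdx h l (S + 1) + 1) = wd l * (c + 1) := by
              rw [Nat.mul_succ, Nat.mul_succ] at he ⊢; omega
            have := Nat.eq_of_mul_eq_mul_left (by omega) h1
            omega

/-- summation operator -/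
def E {h : ℕ} (f : ℕ → ZMod h) (s : ℕ) : ZMod h := ∑ u ∈ Finset.range s, f (u / 2)

/-- iterated summation operator -/
def EI {h : ℕ} : ℕ → (ℕ → ZMod h) → (ℕ → ZMod h)
  | 0, f => f
  | i + 1, f => E (EI i f)

theorem E_succ {h : ℕ} (f : ℕ → ZMod h) (s : ℕ) : E f (s + 1) = E f s + f (s / 2) := by
  unfold E; rw [Finset.sum_range_succ]

theorem E_congr {h : ℕ} {f g : ℕ → ZMod h} {n : ℕ} (H : ∀ t < n, f t = g t) :
    ∀ s < 2 * n + 1, E f s = E g s := by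
  intro s hs
  unfold E
  refine Finset.sum_congr rfl (fun u hu => H _ ?_)
  rw [Finset.mem_range] at hu; omega

theorem size_succ (k : ℕ) : size (k + 1) = 2 * size k + 1 := by
  unfold size
  have : 1 ≤ 2 ^ (k + 1) := Nat.one_le_two_pow
  rw [pow_succ 2 (k + 1)]; omega

theorem EI_lin {h : ℕ} (i k : ℕ) (y : ZMod h) (f g : ℕ → ZMod h)
    (H : ∀ t < size k, g t = y + f t) :
    ∀ t < size (k + i), EI i g t = y * EI i (fun _ => 1) t + EI i f t := by
  induction i with
  | zero => intro t ht; simp [EI, H t ht]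
  | succ i ih =>
    intro t ht
    rw [← add_assoc, size_succ] at ht
    simp only [EI]
    rw [E_congr ih t ht]
    unfold E
    rw [Finset.sum_add_distrib, Finset.mul_sum]

theorem EI_comm {h : ℕ} (i : ℕ) (f : ℕ → ZMod h) : EI i (E f) = EI (i + 1) f := by
  induction i with
  | zero => rfl
  | succ i ih => simp only [EI, ih]

/-- the packed table represents the function -/
def Rp (h l B F : ℕ) (g : ℕ → ZMod h) : Prop :=
  ∃ φ : ℕ → ℕ, (∀ t, φ t ≤ B) ∧ F = gg h * pk (bs h l) φ (size l) 0 ∧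
    ∀ t < size l, (φ t : ZMod h) = g t

theorem Rp.congr {h l B F : ℕ} {f g : ℕ → ZMod h} (H : Rp h l B F f) (hfg : ∀ t < size l, g t = f t) :
    Rp h l B F g := by
  obtain ⟨φ, h1, h2, h3⟩ := H
  exact ⟨φ, h1, h2, fun t ht => by rw [h3 t ht, hfg t ht]⟩

theorem Rp.add {h l B B' F F' z : ℕ} {f g : ℕ → ZMod h} (H : Rp h l B F f) (H' : Rp h l B' F' g) :
    Rp h l (B + z * B') (F + z * F') (fun t => z * g t + f t) := by
  obtain ⟨φ, h1, h2, h3⟩ := H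
  obtain ⟨ψ, k1, k2, k3⟩ := H'
  refine ⟨fun t => φ t + z * ψ t, fun t => add_le_add (h1 t) (Nat.mul_le_mul_left _ (k1 t)), ?_,
    fun t ht => ?_⟩
  · rw [h2, k2, ← pk_add, ← pk_mul]; ring
  · push_cast; rw [h3 t ht, k3 t ht]; ring

theorem pkl_eq (B : ℕ) (L : List ℕ) : pkl B L = pk B (fun t => L.getD t 0) L.length 0 := by
  induction L with
  | nil => rfl
  | cons x L ih =>
    have : pkl B (x :: L) = x + B * pkl B L := rfl
    rw [this, ih, List.length_cons, pk_succ, zero_add, ← zero_add 1, pk_step]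
    simp

theorem expand_spec {h : ℕ} [NeZero h] (w : List ℕ) (f : ℕ → ZMod h) (c : ℕ) (hc : c ≤ h)
    (H : ∀ t < w.length, ((w.getD t 0 : ℕ) : ZMod h) = f t) :
    (expand h w c).length = 2 * w.length + 1 ∧ (∀ t, (expand h w c).getD t 0 ≤ h) ∧
    ∀ t < 2 * w.length + 1, (((expand h w c).getD t 0 : ℕ) : ZMod h) = c + E f t := by
  induction w generalizing f c with
  | nil =>
    have : expand h [] c = [c] := rfl
    rw [this]
    refine ⟨rfl, ?_, ?_⟩
    · intro t; rcases t with _ | t <;> simp [hc]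
    · intro t ht
      have : t = 0 := by simp at ht; omega
      subst this; simp [E]
  | cons x w ih =>
    have e : expand h (x :: w) c = c :: ((c + x) % h) :: expand h w ((c + (x + x)) % h) := rfl
    have hpos : 0 < h := Nat.pos_of_ne_zero (NeZero.ne h)
    obtain ⟨i1, i2, i3⟩ := ih (fun t => f (t + 1)) ((c + (x + x)) % h) (Nat.mod_lt _ hpos).le
      (fun t ht => by
        have := H (t + 1) (by simpa using ht)
        simpa using this)
    have hx : (x : ZMod h) = f 0 := by simpa using H 0 (by simp)
    rw [e]
    refine ⟨by simp [i1]; ring, ?_, ?_⟩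
    · intro t
      rcases t with _ | _ | t
      · simpa using hc
      · simpa using (Nat.mod_lt _ hpos).le
      · simpa using i2 t
    · intro t ht
      rcases t with _ | _ | t
      · simp [E]
      · simp [E, hx]
      · have h1 := i3 t (by simp at ht; omega)
        have h2 : E f (t + 2) = f 0 + f 0 + E (fun t => f (t + 1)) t := by
          unfold E
          rw [Finset.sum_range_succ', Finset.sum_range_succ']
          have : ∀ u, (u + 1 + 1) / 2 = u / 2 + 1 := fun u => by omega
          simp only [this]
          simp; ring
        simp only [List.getD_cons_succ]
        rw [h1, h2]; simp [hx]; ring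

theorem ptab_spec {h : ℕ} [NeZero h] (i l : ℕ) (hi : i ≤ l) :
    (ptab h l i).length = size l ∧ (∀ t, (ptab h l i).getD t 0 ≤ h) ∧
    ∀ t < size l, (((ptab h l i).getD t 0 : ℕ) : ZMod h) = EI i (fun _ => 1) t := by
  have hpos : 0 < h := Nat.pos_of_ne_zero (NeZero.ne h)
  induction i generalizing l with
  | zero =>
    have : ptab h l 0 = List.replicate (size l) 1 := rfl
    rw [this]
    refine ⟨by simp, fun t => ?_, fun t ht => ?_⟩
    · rw [List.getD_eq_getElem?_getD, List.getElem?_replicate]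
      split
      · exact hpos
      · simp
    · rw [List.getD_eq_getElem?_getD, List.getElem?_replicate]
      simp [ht, EI]
  | succ i ih =>
    obtain ⟨l, rfl⟩ : ∃ l', l = l' + 1 := ⟨l - 1, by omega⟩
    have e : ptab h (l + 1) (i + 1) = expand h (ptab h l i) 0 := rfl
    obtain ⟨i1, i2, i3⟩ := ih l (by omega)
    obtain ⟨j1, j2, j3⟩ := expand_spec (ptab h l i) (EI i (fun _ => 1)) 0 (by omega)
      (fun t ht => i3 t (by omega))
    rw [e, size_succ]
    rw [i1] at j1 j3
    refine ⟨j1, j2, fun t ht => ?_⟩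
    rw [j3 t ht]; simp [EI]

theorem P_rp {h : ℕ} [NeZero h] (i l : ℕ) (hi : i ≤ l) : Rp h l h (P h l i) (EI i (fun _ => 1)) := by
  obtain ⟨i1, i2, i3⟩ := ptab_spec (h := h) i l hi
  refine ⟨fun t => (ptab h l i).getD t 0, i2, ?_, i3⟩
  have : P h l i = gg h * pkl (bs h l) (ptab h l i) := rfl
  rw [this, pkl_eq, i1]

/-- families of windows satisfying the recurrence -/
structure Adm {h : ℕ} (g : ℕ → ℕ → ZMod h) : Prop where
  zero : g 0 0 = 0
  step : ∀ k s, s + 1 < size (k + 1) → g (k + 1) (s + 1) = g (k + 1) s + g k (s / 2)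

theorem Adm.eq {h : ℕ} {g : ℕ → ℕ → ZMod h} (H : Adm g) (k : ℕ) :
    ∀ s < size (k + 1), g (k + 1) s = g (k + 1) 0 + E (g k) s := by
  intro s
  induction s with
  | zero => intro _; simp [E]
  | succ s ih => intro hs; rw [H.step k s hs, ih (by omega), E_succ]; ring

def Hit (four : Bool) {h : ℕ} (g : ℕ → ℕ → ZMod h) : Prop :=
  ∃ k, 1 ≤ k ∧ k ≤ 9 ∧ ∃ t < size k, valid four k t = true ∧ g k t = 0

theorem hit_of_bit {four : Bool} {h k B F : ℕ} [NeZero h] {g : ℕ → ℕ → ZMod h} (H : Ok h) (hA : Adm g)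
    (hk : k + 1 ≤ 9) (hB : B ≤ 9 * h * h) (hR : Rp h (k + 1) B F (E (g k))) :
    Hit four g ∨ (test four h (k + 1) F).testBit (wd (k + 1) * ((-g (k + 1) 0).val + 1) - 1) = true := by
  obtain ⟨φ, h1, h2, h3⟩ := hR
  by_cases hall : ∀ t < size (k + 1), valid four (k + 1) t = true → φ t % h ≠ (-g (k + 1) 0).val
  · exact Or.inr (test_sound H hk (fun t => (h1 t).trans hB) h2 (ZMod.val_lt _) hall)
  · push Not at hall
    obtain ⟨t, ht, hv, he⟩ := hall
    refine Or.inl ⟨k + 1, by omega, hk, t, ht, hv, ?_⟩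
    rw [hA.eq k t ht, ← h3 t ht]
    have : ((φ t % h : ℕ) : ZMod h) = -g (k + 1) 0 := by rw [he, ZMod.natCast_zmod_val]
    rw [ZMod.natCast_mod] at this
    rw [this]; ring

theorem node_step {four : Bool} {h k B F : ℕ} [NeZero h] {g : ℕ → ℕ → ZMod h} (H : Ok h) (hA : Adm g)
    (hk : k + 1 ≤ 9) (hB : B ≤ 9 * h * h) (hR : Rp h (k + 1) B F (E (g k))) (child : ℕ → Bool)
    (hL : loop h (k + 1) child h (test four h (k + 1) F) = true) :
    Hit four g ∨ ∃ z ≤ h, (z : ZMod h) = g (k + 1) 0 ∧ child z = true := by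
  rcases hit_of_bit (four := four) H hA hk hB hR with h1 | h1
  · exact Or.inl h1
  · refine Or.inr ⟨h - (-g (k + 1) 0).val, by omega, ?_, loop_sound _ _ _ _ _ hL _ h1⟩
    rw [Nat.cast_sub (ZMod.val_lt _).le, ZMod.natCast_zmod_val]; simp

/-- updating a table by the next unknown -/
theorem Rp.next {h k l B F z : ℕ} [NeZero h] {g : ℕ → ℕ → ZMod h} (hA : Adm g)
    (hR : Rp h l B F (EI (l - k) (g k))) (hkl : k + 1 ≤ l) (hz : z ≤ h) (hzg : (z : ZMod h) = g (k + 1) 0) :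
    Rp h l (B + h * h) (F + z * P h l (l - (k + 1))) (EI (l - (k + 1)) (g (k + 1))) := by
  have h1 : Rp h l (B + z * h) _ _ := hR.add (z := z) (P_rp (h := h) (l - (k + 1)) l (by omega))
  have h2 : Rp h l (B + h * h) (F + z * P h l (l - (k + 1)))
      (fun t => (z : ZMod h) * EI (l - (k + 1)) (fun _ => 1) t + EI (l - k) (g k) t) := by
    obtain ⟨φ, a1, a2, a3⟩ := h1
    exact ⟨φ, fun t => (a1 t).trans (Nat.add_le_add_left (Nat.mul_le_mul_right _ hz) _), a2, a3⟩
  refine h2.congr (fun t ht => ?_)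
  have h3 := EI_lin (l - (k + 1)) (k + 1) (g (k + 1) 0) (E (g k)) (g (k + 1)) (hA.eq k) t
    (by rw [show k + 1 + (l - (k + 1)) = l by omega]; exact ht)
  rw [h3, EI_comm, hzg, show l - (k + 1) + 1 = l - k by omega]

end BP

namespace BP

/-- state of a table before the unknown of level `k + 1` is known -/
def St {h : ℕ} (g : ℕ → ℕ → ZMod h) (k l F : ℕ) : Prop := Rp h l (k * (h * h)) F (EI (l - k) (g k))

theorem St.next {h k l F z : ℕ} [NeZero h] {g : ℕ → ℕ → ZMod h} (hA : Adm g)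
    (hR : St g k l F) (hkl : k + 1 ≤ l) (hz : z ≤ h) (hzg : (z : ZMod h) = g (k + 1) 0) :
    St g (k + 1) l (F + z * P h l (l - (k + 1))) := by
  unfold St
  rw [Nat.succ_mul]
  exact Rp.next hA hR hkl hz hzg

theorem St.step {four : Bool} {h k F : ℕ} [NeZero h] {g : ℕ → ℕ → ZMod h} (H : Ok h) (hA : Adm g)
    (hk : k + 1 ≤ 9) (hR : St g k (k + 1) F) (child : ℕ → Bool)
    (hL : loop h (k + 1) child h (test four h (k + 1) F) = true)
    (hch : ∀ z ≤ h, (z : ZMod h) = g (k + 1) 0 → child z = true → Hit four g) :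
    Hit four g := by
  have hR' : Rp h (k + 1) (k * (h * h)) F (E (g k)) := by
    have h1 : Rp h (k + 1) (k * (h * h)) F (EI (k + 1 - k) (g k)) := hR
    rwa [show k + 1 - k = 1 by omega] at h1
  rcases node_step H hA hk (by nlinarith) hR' child hL with h1 | ⟨z, h1, h2, h3⟩
  · exact h1
  · exact hch z h1 h2 h3

theorem n9_sound {four : Bool} {h F9 : ℕ} [NeZero h] {g : ℕ → ℕ → ZMod h} (H : Ok h) (hA : Adm g)
    (s9 : St g 8 9 F9) (hn : n9 four h F9 = true) : Hit four g := by
  rcases hit_of_bit (four := four) (k := 8) H hA (by norm_num) (by nlinarith) s9 with h1 | h1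
  · exact h1
  · have : test four h 9 F9 = 0 := Nat.eq_of_beq_eq_true hn
    rw [this] at h1
    simp at h1

theorem n8_sound {four : Bool} {h F8 F9 : ℕ} [NeZero h] {g : ℕ → ℕ → ZMod h}
    (H : Ok h) (hA : Adm g) (s8 : St g 7 8 F8) (s9 : St g 7 9 F9)
    (hn : n8 four h F8 F9 = true) : Hit four g :=
  St.step H hA (by norm_num) s8 _ hn (fun _ hz hg hc => n9_sound H hA
    (s9.next hA (by norm_num) hz hg) hc)

theorem n7_sound {four : Bool} {h F7 F8 F9 : ℕ} [NeZero h] {g : ℕ → ℕ → ZMod h}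
    (H : Ok h) (hA : Adm g) (s7 : St g 6 7 F7) (s8 : St g 6 8 F8) (s9 : St g 6 9 F9)
    (hn : n7 four h F7 F8 F9 = true) : Hit four g :=
  St.step H hA (by norm_num) s7 _ hn (fun _ hz hg hc => n8_sound H hA
    (s8.next hA (by norm_num) hz hg) (s9.next hA (by norm_num) hz hg) hc)

theorem n6_sound {four : Bool} {h F6 F7 F8 F9 : ℕ} [NeZero h] {g : ℕ → ℕ → ZMod h}
    (H : Ok h) (hA : Adm g) (s6 : St g 5 6 F6) (s7 : St g 5 7 F7) (s8 : St g 5 8 F8) (s9 : St g 5 9 F9)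
    (hn : n6 four h F6 F7 F8 F9 = true) : Hit four g :=
  St.step H hA (by norm_num) s6 _ hn (fun _ hz hg hc => n7_sound H hA
    (s7.next hA (by norm_num) hz hg) (s8.next hA (by norm_num) hz hg) (s9.next hA (by norm_num) hz hg) hc)

theorem n5_sound {four : Bool} {h F5 F6 F7 F8 F9 : ℕ} [NeZero h] {g : ℕ → ℕ → ZMod h}
    (H : Ok h) (hA : Adm g) (s5 : St g 4 5 F5) (s6 : St g 4 6 F6) (s7 : St g 4 7 F7) (s8 : St g 4 8 F8) (s9 : St g 4 9 F9)
    (hn : n5 four h F5 F6 F7 F8 F9 = true) : Hit four g :=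
  St.step H hA (by norm_num) s5 _ hn (fun _ hz hg hc => n6_sound H hA
    (s6.next hA (by norm_num) hz hg) (s7.next hA (by norm_num) hz hg) (s8.next hA (by norm_num) hz hg) (s9.next hA (by norm_num) hz hg) hc)

theorem n4_sound {four : Bool} {h F4 F5 F6 F7 F8 F9 : ℕ} [NeZero h] {g : ℕ → ℕ → ZMod h}
    (H : Ok h) (hA : Adm g) (s4 : St g 3 4 F4) (s5 : St g 3 5 F5) (s6 : St g 3 6 F6) (s7 : St g 3 7 F7) (s8 : St g 3 8 F8) (s9 : St g 3 9 F9)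
    (hn : n4 four h F4 F5 F6 F7 F8 F9 = true) : Hit four g :=
  St.step H hA (by norm_num) s4 _ hn (fun _ hz hg hc => n5_sound H hA
    (s5.next hA (by norm_num) hz hg) (s6.next hA (by norm_num) hz hg) (s7.next hA (by norm_num) hz hg) (s8.next hA (by norm_num) hz hg) (s9.next hA (by norm_num) hz hg) hc)

theorem n3_sound {four : Bool} {h F3 F4 F5 F6 F7 F8 F9 : ℕ} [NeZero h] {g : ℕ → ℕ → ZMod h}
    (H : Ok h) (hA : Adm g) (s3 : St g 2 3 F3) (s4 : St g 2 4 F4) (s5 : St g 2 5 F5) (s6 : St g 2 6 F6) (s7 : St g 2 7 F7) (s8 : St g 2 8 F8) (s9 : St g 2 9 F9)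
    (hn : n3 four h F3 F4 F5 F6 F7 F8 F9 = true) : Hit four g :=
  St.step H hA (by norm_num) s3 _ hn (fun _ hz hg hc => n4_sound H hA
    (s4.next hA (by norm_num) hz hg) (s5.next hA (by norm_num) hz hg) (s6.next hA (by norm_num) hz hg) (s7.next hA (by norm_num) hz hg) (s8.next hA (by norm_num) hz hg) (s9.next hA (by norm_num) hz hg) hc)

theorem St.base {h l y1 y2 : ℕ} [NeZero h] {g : ℕ → ℕ → ZMod h} (hA : Adm g) (hl : 2 ≤ l)
    (h1 : y1 ≤ h) (h2 : y2 ≤ h) (e1 : (y1 : ZMod h) = g 1 0) (e2 : (y2 : ZMod h) = g 2 0) :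
    St g 2 l (ini h y1 y2 l) := by
  have hz : ∀ i, ∀ t < size i, EI i (g 0) t = 0 := by
    intro i
    induction i with
    | zero =>
      intro t ht
      have : t = 0 := by simp [size] at ht; exact ht
      rw [this]; exact hA.zero
    | succ i ih =>
      intro t ht
      rw [size_succ] at ht
      simp only [EI]
      rw [E_congr (g := fun _ => 0) ih t ht]
      simp [E]
  have s0 : St g 0 l 0 := by
    refine ⟨fun _ => 0, fun _ => by simp, ?_, fun t ht => ?_⟩
    · have := pk_mul (bs h l) 0 (fun _ => 0) (size l) 0
      simp only [zero_mul] at this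
      rw [← this]; simp
    · rw [Nat.sub_zero, hz l t ht]; simp
  have s2 := (s0.next hA (by omega) h1 e1).next hA (by omega) h2 e2
  simp only [zero_add] at s2
  exact s2

theorem check_sound {four : Bool} {h y1 y2 : ℕ} [NeZero h] (H : Ok h) (hc : check four h y1 y2 = true)
    (h1 : y1 ≤ h) (h2 : y2 ≤ h) (g : ℕ → ℕ → ZMod h) (hA : Adm g)
    (e1 : (y1 : ZMod h) = g 1 0) (e2 : (y2 : ZMod h) = g 2 0) : Hit four g := by
  have s : ∀ l, 2 ≤ l → St g 2 l (ini h y1 y2 l) := fun l hl => St.base hA hl h1 h2 e1 e2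
  exact n3_sound H hA (s 3 (by norm_num)) (s 4 (by norm_num)) (s 5 (by norm_num)) (s 6 (by norm_num))
    (s 7 (by norm_num)) (s 8 (by norm_num)) (s 9 (by norm_num)) hc

end BP

namespace BP

theorem Adm.smul {h : ℕ} {g : ℕ → ℕ → ZMod h} (H : Adm g) (u : ZMod h) : Adm (fun k t => u * g k t) :=
  ⟨by rw [H.zero, mul_zero], fun k s hs => by rw [H.step k s hs]; ring⟩

theorem Hit.of_smul {four : Bool} {h : ℕ} {g : ℕ → ℕ → ZMod h} {u : ZMod h} (hu : IsUnit u)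
    (H : Hit four (fun k t => u * g k t)) : Hit four g := by
  obtain ⟨k, h1, h2, t, ht, hv, he⟩ := H
  exact ⟨k, h1, h2, t, ht, hv, (hu.mul_right_eq_zero).1 he⟩

/-- reversal of the windows -/
def rv {h : ℕ} (g : ℕ → ℕ → ZMod h) (k t : ℕ) : ZMod h := (-1) ^ (k + 1) * g k (size k - 1 - t)

theorem size_pos (k : ℕ) : 0 < size k := by
  unfold size
  have : 2 ^ 1 ≤ 2 ^ (k + 1) := Nat.pow_le_pow_right (by norm_num) (by omega)
  omega

theorem Adm.rv {h : ℕ} {g : ℕ → ℕ → ZMod h} (H : Adm g) : Adm (rv g) := by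
  refine ⟨?_, fun k s hs => ?_⟩
  · unfold BP.rv
    have : size 0 - 1 - 0 = 0 := rfl
    rw [this, H.zero, mul_zero]
  · unfold BP.rv
    have hp := size_pos k
    obtain ⟨r, hr⟩ : ∃ r, r = 2 * size k - 1 - s := ⟨_, rfl⟩
    rw [size_succ] at hs ⊢
    have e1 : 2 * size k + 1 - 1 - (s + 1) = r := by omega
    have e2 : 2 * size k + 1 - 1 - s = r + 1 := by omega
    have e3 : size k - 1 - s / 2 = r / 2 := by omega
    rw [e1, e2, e3, H.step k r (by rw [size_succ]; omega), pow_succ]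
    ring

theorem valid_rev : ∀ four : Bool, ∀ k ≤ 9, ∀ t < size k,
    valid four k (size k - 1 - t) = true → valid four k t = true := by
  decide +kernel

theorem Hit.of_rv {four : Bool} {h : ℕ} {g : ℕ → ℕ → ZMod h} (H : Hit four (rv g)) : Hit four g := by
  obtain ⟨k, h1, h2, t, ht, hv, he⟩ := H
  refine ⟨k, h1, h2, size k - 1 - t, by omega, ?_, ?_⟩
  · apply valid_rev four k h2 _ (by omega)
    rwa [show size k - 1 - (size k - 1 - t) = t by omega]
  · have hu : IsUnit ((-1 : ZMod h) ^ (k + 1)) := (isUnit_one.neg).pow _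
    exact (hu.mul_right_eq_zero).1 he

theorem Adm.one {h : ℕ} {g : ℕ → ℕ → ZMod h} (H : Adm g) : ∀ t < 3, g 1 t = g 1 0 := by
  intro t ht
  have h1 := H.eq 0 t ht
  rw [h1]
  have : E (g 0) t = 0 := by
    unfold E
    refine Finset.sum_eq_zero (fun u hu => ?_)
    rw [Finset.mem_range] at hu
    rw [show u / 2 = 0 by omega, H.zero]
  rw [this, add_zero]

theorem Adm.two {h : ℕ} {g : ℕ → ℕ → ZMod h} (H : Adm g) : ∀ t < 7, g 2 t = g 2 0 + t * g 1 0 := by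
  intro t ht
  rw [H.eq 1 t ht]
  have : E (g 1) t = ∑ u ∈ Finset.range t, g 1 0 :=
    Finset.sum_congr rfl (fun u hu => H.one _ (by rw [Finset.mem_range] at hu; omega))
  rw [this]; simp

/-- all families with given first unknowns hit zero -/
def Q (four : Bool) (h : ℕ) (y1 y2 : ZMod h) : Prop :=
  ∀ g : ℕ → ℕ → ZMod h, Adm g → g 1 0 = y1 → g 2 0 = y2 → Hit four g

theorem Q.scale {four : Bool} {h : ℕ} {y1 y2 : ZMod h} (u : (ZMod h)ˣ) (H : Q four h y1 y2) :
    Q four h (u * y1) (u * y2) := by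
  intro g hA e1 e2
  refine Hit.of_smul (u := ((u⁻¹ : (ZMod h)ˣ) : ZMod h)) (Units.isUnit _) (H _ (hA.smul _) ?_ ?_)
  · rw [e1, Units.inv_mul_cancel_left]
  · rw [e2, Units.inv_mul_cancel_left]

theorem Q.refl {four : Bool} {h : ℕ} {y1 y2 : ZMod h} (H : Q four h y1 y2) :
    Q four h y1 (-y2 - 6 * y1) := by
  intro g hA e1 e2
  refine Hit.of_rv (H _ hA.rv ?_ ?_)
  · have : rv g 1 0 = (-1) ^ 2 * g 1 2 := rfl
    rw [this, hA.one 2 (by norm_num), e1]; ring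
  · have : rv g 2 0 = (-1) ^ 3 * g 2 6 := rfl
    rw [this, hA.two 6 (by norm_num), e1, e2]; push_cast; ring

/-- immediate hits in the first two windows -/
def early (four : Bool) (h d y : ℕ) : Bool :=
  (List.range 7).any fun t => valid four 2 t && Nat.beq ((y + t * d) % h) 0

def covA (four : Bool) (h : ℕ) (D : List ℕ) : Bool :=
  (List.range h).all fun y => (valid four 1 0 && Nat.beq y 0) ||
    D.any fun d => (List.range h).any fun u => Nat.beq (u * d % h) y && Nat.beq (Nat.gcd u h) 1

def covB (four : Bool) (h : ℕ) (D : List ℕ) (R : List (ℕ × ℕ)) : Bool :=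
  D.all fun d => (List.range h).all fun y => early four h d y ||
    R.any fun p => Nat.beq p.1 d && (List.range h).any fun u => Nat.beq (Nat.gcd u h) 1 &&
      (Nat.beq ((u * d) % h) (d % h)) &&
        (Nat.beq (u * p.2 % h) y || Nat.beq ((u * p.2 + 6 * d + y) % h) 0)

def small (h : ℕ) (R : List (ℕ × ℕ)) : Bool := R.all fun p => Nat.ble p.1 h && Nat.ble p.2 h

def cov (four : Bool) (h : ℕ) (D : List ℕ) (R : List (ℕ × ℕ)) : Bool :=
  small h R && (covA four h D && covB four h D R)

theorem early_sound {four : Bool} {h d y : ℕ} [NeZero h] (H : early four h d y = true) :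
    Q four h d y := by
  intro g hA e1 e2
  unfold early at H
  rw [List.any_eq_true] at H
  obtain ⟨t, ht, H⟩ := H
  rw [Bool.and_eq_true] at H
  have ht' : t < 7 := List.mem_range.1 ht
  refine ⟨2, by norm_num, by norm_num, t, ht', H.1, ?_⟩
  rw [hA.two t ht', e1, e2]
  have := (ZMod.natCast_eq_zero_iff _ _).2 (Nat.dvd_of_mod_eq_zero (Nat.eq_of_beq_eq_true H.2))
  push_cast at this
  exact this

theorem all_hit {four : Bool} {h : ℕ} [NeZero h] {D : List ℕ} {R : List (ℕ × ℕ)} (H : Ok h)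
    (hcov : cov four h D R = true) (hR : ∀ p ∈ R, check four h p.1 p.2 = true)
    (g : ℕ → ℕ → ZMod h) (hA : Adm g) : Hit four g := by
  unfold cov at hcov
  simp only [Bool.and_eq_true] at hcov
  obtain ⟨hS, hCA, hCB⟩ := hcov
  have hQ : ∀ p ∈ R, Q four h p.1 p.2 := by
    intro p hp g hA e1 e2
    unfold small at hS
    have := (List.all_eq_true.1 hS) p hp
    rw [Bool.and_eq_true] at this
    exact check_sound H (hR p hp) (Nat.le_of_ble_eq_true this.1) (Nat.le_of_ble_eq_true this.2) g hA
      e1.symm e2.symm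
  have hunit : ∀ u : ℕ, Nat.beq (Nat.gcd u h) 1 = true → ∃ v : (ZMod h)ˣ, (v : ZMod h) = u := fun u hu =>
    ⟨ZMod.unitOfCoprime u (Nat.eq_of_beq_eq_true hu), ZMod.coe_unitOfCoprime _ _⟩
  have hB : ∀ d ∈ D, ∀ y2 : ZMod h, Q four h d y2 := by
    intro d hd y2
    have h1 := (List.all_eq_true.1 ((List.all_eq_true.1 hCB) d hd)) y2.val
      (List.mem_range.2 (ZMod.val_lt _))
    have ey : ((y2.val : ℕ) : ZMod h) = y2 := ZMod.natCast_zmod_val y2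
    rw [Bool.or_eq_true] at h1
    rcases h1 with h1 | h1
    · have := early_sound h1
      rwa [ey] at this
    · obtain ⟨p, hp, h1⟩ := List.any_eq_true.1 h1
      rw [Bool.and_eq_true] at h1
      obtain ⟨hpd, h1⟩ := h1
      obtain ⟨u, -, h1⟩ := List.any_eq_true.1 h1
      rw [Bool.and_eq_true, Bool.and_eq_true, Bool.or_eq_true] at h1
      obtain ⟨⟨h2, h3⟩, h4⟩ := h1
      obtain ⟨v, hv⟩ := hunit u h2
      have hpd' := Nat.eq_of_beq_eq_true hpd
      have h3' : (u : ZMod h) * d = d := by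
        have := (ZMod.natCast_eq_natCast_iff' (u * d) d h).2 (Nat.eq_of_beq_eq_true h3)
        push_cast at this; exact this
      have q := (hQ p hp).scale v
      rw [hv, hpd', h3'] at q
      rcases h4 with h4 | h4
      · have : (u : ZMod h) * p.2 = y2 := by
          rw [← ey, ← Nat.eq_of_beq_eq_true h4, ZMod.natCast_mod]; push_cast; rfl
        rwa [this] at q
      · have q' := q.refl
        have : -((u : ZMod h) * p.2) - 6 * d = y2 := by
          have := (ZMod.natCast_eq_zero_iff _ _).2 (Nat.dvd_of_mod_eq_zero (Nat.eq_of_beq_eq_true h4))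
          push_cast at this
          rw [ey] at this
          linear_combination -this
        rwa [this] at q'
  have h1 := (List.all_eq_true.1 hCA) (g 1 0).val (List.mem_range.2 (ZMod.val_lt _))
  rw [Bool.or_eq_true, Bool.and_eq_true] at h1
  rcases h1 with ⟨h1, h2⟩ | h1
  · refine ⟨1, by norm_num, by norm_num, 0, by norm_num [size], h1, ?_⟩
    exact (ZMod.val_eq_zero _).1 (Nat.eq_of_beq_eq_true h2)
  · obtain ⟨d, hd, h1⟩ := List.any_eq_true.1 h1
    obtain ⟨u, -, h1⟩ := List.any_eq_true.1 h1
    rw [Bool.and_eq_true] at h1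
    obtain ⟨v, hv⟩ := hunit u h1.2
    have h3 : (v : ZMod h) * d = g 1 0 := by
      rw [hv, ← ZMod.natCast_zmod_val (g 1 0), ← Nat.eq_of_beq_eq_true h1.1, ZMod.natCast_mod]
      push_cast; rfl
    have q := (hB d hd (((v⁻¹ : (ZMod h)ˣ) : ZMod h) * g 2 0)).scale v
    rw [h3, Units.mul_inv_cancel_left] at q
    exact q g hA rfl rfl

end BP

namespace BP

/-- weight of a representation -/
noncomputable def wt (f : ℕ →₀ ℕ) : ℕ := f.sum fun i c => c * 2 ^ i

theorem wt_up (f : ℕ →₀ ℕ) : wt (f + Finsupp.single 0 1) = wt f + 1 := by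
  unfold wt
  rw [Finsupp.sum_add_index' (by simp) (by intros; ring), Finsupp.sum_single_index (by simp)]
  simp

theorem wt_shift (f : ℕ →₀ ℕ) : wt (f.mapDomain Nat.succ) = 2 * wt f := by
  unfold wt
  rw [Finsupp.sum_mapDomain_index (by simp) (by intros; ring), Finsupp.sum, Finsupp.sum, Finset.mul_sum]
  refine Finset.sum_congr rfl (fun i _ => ?_)
  rw [Nat.succ_eq_add_one, pow_succ]; ring

/-- representations of `n` -/
def S (n : ℕ) : Set (ℕ →₀ ℕ) := {f | wt f = n}

theorem up_inj : Function.Injective (fun f : ℕ →₀ ℕ => f + Finsupp.single 0 1) :=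
  fun _ _ hab => add_right_cancel hab

theorem shift_inj : Function.Injective (fun f : ℕ →₀ ℕ => f.mapDomain Nat.succ) :=
  Finsupp.mapDomain_injective Nat.succ_injective

theorem shift_zero (f : ℕ →₀ ℕ) : f.mapDomain Nat.succ 0 = 0 :=
  Finsupp.mapDomain_of_notMem_range _ _ (by rintro ⟨x, hx⟩; exact Nat.succ_ne_zero x hx)

theorem exists_up {f : ℕ →₀ ℕ} (hf : f 0 ≠ 0) : ∃ e, e + Finsupp.single 0 1 = f :=
  ⟨f - Finsupp.single 0 1, tsub_add_cancel_of_le (Finsupp.single_le_iff.2 (by omega))⟩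

theorem exists_shift {f : ℕ →₀ ℕ} (hf : f 0 = 0) : ∃ e : ℕ →₀ ℕ, e.mapDomain Nat.succ = f := by
  refine ⟨f.comapDomain Nat.succ Nat.succ_injective.injOn,
    Finsupp.mapDomain_comapDomain _ Nat.succ_injective _ ?_⟩
  intro x hx
  rcases x with _ | x
  · simp [hf] at hx
  · exact ⟨x, rfl⟩

theorem S_zero : S 0 = {0} := by
  ext f
  simp only [S, Set.mem_ofPred_eq, Set.mem_singleton_iff, wt]
  constructor
  · intro h
    ext i
    by_contra hi
    have h1 : f i * 2 ^ i = 0 := by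
      rw [Finsupp.sum, Finset.sum_eq_zero_iff] at h
      exact h i (Finsupp.mem_support_iff.2 hi)
    simp at h1
    exact hi (by simpa using h1)
  · rintro rfl; simp

theorem S_odd (n : ℕ) : S (2 * n + 1) = (fun f => f + Finsupp.single 0 1) '' S (2 * n) := by
  ext f
  simp only [S, Set.mem_image, Set.mem_ofPred_eq]
  constructor
  · intro h
    by_cases hf : f 0 = 0
    · obtain ⟨e, rfl⟩ := exists_shift hf
      rw [wt_shift] at h; omega
    · obtain ⟨e, rfl⟩ := exists_up hf
      rw [wt_up] at h
      exact ⟨e, by omega, rfl⟩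
  · rintro ⟨e, he, rfl⟩; rw [wt_up, he]

theorem S_even (n : ℕ) : S (2 * n + 2) = (fun f => f + Finsupp.single 0 1) '' S (2 * n + 1) ∪
    (fun f : ℕ →₀ ℕ => f.mapDomain Nat.succ) '' S (n + 1) := by
  ext f
  simp only [S, Set.mem_union, Set.mem_image, Set.mem_ofPred_eq]
  constructor
  · intro h
    by_cases hf : f 0 = 0
    · obtain ⟨e, rfl⟩ := exists_shift hf
      rw [wt_shift] at h
      exact Or.inr ⟨e, by omega, rfl⟩
    · obtain ⟨e, rfl⟩ := exists_up hf
      rw [wt_up] at h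
      exact Or.inl ⟨e, by omega, rfl⟩
  · rintro (⟨e, he, rfl⟩ | ⟨e, he, rfl⟩)
    · rw [wt_up, he]
    · rw [wt_shift, he]; ring

theorem S_fin (n : ℕ) : (S n).Finite := by
  induction n using Nat.strong_induction_on with
  | _ n ih =>
    rcases Nat.even_or_odd' n with ⟨k, rfl | rfl⟩
    · rcases k with _ | k
      · rw [Nat.mul_zero, S_zero]; exact Set.finite_singleton _
      · rw [Nat.mul_succ, S_even]
        exact ((ih _ (by omega)).image _).union ((ih _ (by omega)).image _)
    · rw [S_odd]; exact (ih _ (by omega)).image _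

theorem b_eq (n : ℕ) : mAryPartitions 2 n = (S n).ncard := rfl

theorem b_zero : mAryPartitions 2 0 = 1 := by rw [b_eq, S_zero, Set.ncard_singleton]

theorem b_odd (n : ℕ) : mAryPartitions 2 (2 * n + 1) = mAryPartitions 2 (2 * n) := by
  rw [b_eq, b_eq, S_odd, Set.ncard_image_of_injective _ up_inj]

theorem b_even (n : ℕ) : mAryPartitions 2 (2 * n + 2) =
    mAryPartitions 2 (2 * n + 1) + mAryPartitions 2 (n + 1) := by
  rw [b_eq, b_eq, b_eq, S_even, Set.ncard_union_eq _ ((S_fin _).image _) ((S_fin _).image _),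
    Set.ncard_image_of_injective _ up_inj, Set.ncard_image_of_injective _ shift_inj]
  rw [Set.disjoint_left]
  rintro f ⟨e, -, rfl⟩ ⟨e', -, he'⟩
  have := DFunLike.congr_fun he' 0
  simp only [shift_zero] at this
  simp at this

/-- the values at even arguments -/
noncomputable def a (m : ℕ) : ℕ := mAryPartitions 2 (2 * m)

theorem b_a (n : ℕ) : mAryPartitions 2 n = a (n / 2) := by
  rcases Nat.even_or_odd' n with ⟨k, rfl | rfl⟩
  · rw [a]; congr 1; omega
  · rw [b_odd, a]; congr 1; omega

theorem a_zero : a 0 = 1 := b_zero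

theorem a_succ (m : ℕ) : a (m + 1) = a m + a ((m + 1) / 2) := by
  have h1 : a (m + 1) = mAryPartitions 2 (2 * m + 2) := rfl
  rw [h1, b_even, b_odd, ← b_a]; rfl

theorem a_one : a 1 = 2 := by
  have := a_succ 0
  norm_num [a_zero] at this; exact this

theorem a_even (m : ℕ) (hm : 1 ≤ m) : a m % 2 = 0 := by
  induction m using Nat.strong_induction_on with
  | _ m ih =>
    rcases m with _ | _ | m
    · omega
    · rw [zero_add, a_one]
    · have h1 := ih (m + 1) (by omega) (by omega)
      have h2 := ih ((m + 1 + 1) / 2) (by omega) (by omega)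
      rw [a_succ]; omega

theorem a_odd (m : ℕ) : a (2 * m + 1) % 4 = 2 := by
  induction m with
  | zero => rw [Nat.mul_zero, zero_add, a_one]
  | succ m ih =>
    have h1 := a_succ (2 * (m + 1))
    have h2 := a_succ (2 * m + 1)
    rw [show (2 * (m + 1) + 1) / 2 = m + 1 by omega] at h1
    rw [show (2 * m + 1 + 1) / 2 = m + 1 by omega, show 2 * m + 1 + 1 = 2 * (m + 1) by ring] at h2
    have := a_even (m + 1) (by omega)
    omega

theorem a_double (m : ℕ) (hm : 1 ≤ m) : a (2 * m) % 4 = (2 + a m) % 4 := by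
  obtain ⟨m, rfl⟩ : ∃ m', m = m' + 1 := ⟨m - 1, by omega⟩
  have h2 := a_succ (2 * m + 1)
  rw [show (2 * m + 1 + 1) / 2 = m + 1 by omega, show 2 * m + 1 + 1 = 2 * (m + 1) by ring] at h2
  have := a_odd m
  omega

theorem a_four (i c : ℕ) : 4 ∣ a (2 ^ (2 * i + 1) * (2 * c + 1)) := by
  have h0 : ∀ i, 1 ≤ 2 ^ i * (2 * c + 1) := fun i => Nat.mul_pos (by positivity) (by omega)
  induction i with
  | zero =>
    have h1 := a_double (2 * c + 1) (by omega)
    have h2 := a_odd c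
    rw [show 2 * 0 + 1 = 1 by norm_num, pow_one]
    omega
  | succ i ih =>
    have h1 := a_double (2 ^ (2 * i + 1) * (2 * c + 1)) (h0 _)
    have h2 := a_double (2 * (2 ^ (2 * i + 1) * (2 * c + 1))) (by have := h0 (2 * i + 1); omega)
    rw [show 2 ^ (2 * (i + 1) + 1) * (2 * c + 1) = 2 * (2 * (2 ^ (2 * i + 1) * (2 * c + 1))) by ring]
    omega

theorem oddVal_sound (fuel m : ℕ) (H : oddVal fuel m = true) :
    ∃ i c, m = 2 ^ (2 * i + 1) * (2 * c + 1) := by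
  induction fuel generalizing m with
  | zero => exact absurd H (by simp [oddVal])
  | succ fuel ih =>
    have H' : cond (Nat.beq (m % 2) 1) false (cond (Nat.beq (m % 4) 2) true (oddVal fuel (m / 4))) = true := H
    cases h1 : Nat.beq (m % 2) 1 with
    | true => rw [h1] at H'; exact absurd H' (by simp)
    | false =>
      rw [h1, cond_false] at H'
      have h1' := Nat.ne_of_beq_eq_false h1
      cases h2 : Nat.beq (m % 4) 2 with
      | true =>
        have := Nat.eq_of_beq_eq_true h2
        exact ⟨0, m / 4, by rw [show 2 * 0 + 1 = 1 by norm_num, pow_one]; omega⟩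
      | false =>
        rw [h2, cond_false] at H'
        have h2' := Nat.ne_of_beq_eq_false h2
        obtain ⟨i, c, hic⟩ := ih _ H'
        refine ⟨i + 1, c, ?_⟩
        rw [show 2 ^ (2 * (i + 1) + 1) * (2 * c + 1) = 4 * (2 ^ (2 * i + 1) * (2 * c + 1)) by ring, ← hic]
        omega

theorem four_valid {k t : ℕ} (ht : t < size k) (hv : valid true k t = true) (M : ℕ) :
    4 ∣ a (2 ^ k * M + 1 + t) := by
  have hv' : cond (Nat.beq (t + 1) (2 ^ k)) false (oddVal 12 (t + 1)) = true := hv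
  cases h1 : Nat.beq (t + 1) (2 ^ k) with
  | true => rw [h1] at hv'; exact absurd hv' (by simp)
  | false =>
    rw [h1, cond_false] at hv'
    have h1' := Nat.ne_of_beq_eq_false h1
    obtain ⟨i, c, hic⟩ := oddVal_sound _ _ hv'
    unfold size at ht
    have hlt : 2 * i + 1 < k := by
      by_contra hge
      rcases Nat.lt_or_ge k (2 * i + 1) with h2 | h2
      · have h3 : 2 ^ (k + 1) ≤ 2 ^ (2 * i + 1) := Nat.pow_le_pow_right (by norm_num) h2
        have : 2 ^ (2 * i + 1) * 1 ≤ 2 ^ (2 * i + 1) * (2 * c + 1) := Nat.mul_le_mul_left _ (by omega)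
        omega
      · have h3 : 2 * i + 1 = k := by omega
        rw [h3] at hic
        rcases c with _ | c
        · apply h1'; rw [hic]; ring
        · have : 2 ^ k * 2 ≤ 2 ^ k * (2 * (c + 1) + 1) := Nat.mul_le_mul_left _ (by omega)
          rw [pow_succ] at ht
          omega
    obtain ⟨j, hj⟩ : ∃ j, k = 2 * i + 1 + (j + 1) := ⟨k - (2 * i + 1) - 1, by omega⟩
    have : 2 ^ k * M + 1 + t = 2 ^ (2 * i + 1) * (2 * (2 ^ j * M + c) + 1) := by
      rw [show 2 ^ k * M + 1 + t = 2 ^ k * M + (t + 1) by ring, hic, hj, pow_add, pow_succ]; ring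
    rw [this]
    exact a_four _ _

/-- first values modulo `h` -/
def itab (h i : ℕ) : List ℕ := Nat.rec [2] (fun _ ih => expand h ih 2) i

theorem itab_spec {h : ℕ} [NeZero h] (hh : 2 ≤ h) (i : ℕ) : (itab h i).length = size i ∧
    ∀ t < size i, (((itab h i).getD t 0 : ℕ) : ZMod h) = a (1 + t) := by
  induction i with
  | zero =>
    refine ⟨rfl, fun t ht => ?_⟩
    have : t = 0 := by simp [size] at ht; exact ht
    subst this
    rw [add_zero, a_one]; rfl
  | succ i ih =>
    have e : itab h (i + 1) = expand h (itab h i) 2 := rfl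
    obtain ⟨j1, _, j3⟩ := expand_spec (itab h i) (fun t => (a (1 + t) : ZMod h)) 2 hh
      (fun t ht => ih.2 t (by rw [← ih.1]; exact ht))
    rw [e, size_succ, ← ih.1]
    refine ⟨j1, fun t ht => ?_⟩
    rw [j3 t ht]
    clear j1 j3 ht e
    induction t with
    | zero => simp [E, a_one]
    | succ t ih2 =>
      rw [E_succ, ← add_assoc, ih2, show 1 + (t + 1) = 1 + t + 1 by ring, a_succ (1 + t),
        show (1 + t + 1) / 2 = 1 + t / 2 by omega]
      push_cast; rfl

theorem start {h : ℕ} [NeZero h] (hh : 3 ≤ h) (H : (itab h 9).elem 0 = true) :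
    ∃ n, 2 ≤ n ∧ h ∣ a n := by
  obtain ⟨i1, i2⟩ := itab_spec (h := h) (by omega) 9
  have hm : 0 ∈ itab h 9 := List.elem_iff.1 H
  obtain ⟨t, ht, he⟩ := List.getElem_of_mem hm
  have h1 := i2 t (by rw [← i1]; exact ht)
  rw [List.getD_eq_getElem _ _ ht, he, Nat.cast_zero] at h1
  have h2 : h ∣ a (1 + t) := (ZMod.natCast_eq_zero_iff _ _).1 h1.symm
  refine ⟨1 + t, ?_, h2⟩
  rcases t with _ | t
  · rw [add_zero, a_one] at h2
    have := Nat.le_of_dvd (by norm_num) h2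
    omega
  · omega

theorem next_zero {four : Bool} {h : ℕ} (hit : ∀ g : ℕ → ℕ → ZMod h, Adm g → Hit four g) (n : ℕ)
    (hn : 2 ≤ n) (h0 : h ∣ a n) : ∃ m, n < m ∧ h ∣ a m ∧ (four = true → 4 ∣ a m) := by
  have hA : Adm (fun k t => (a (2 ^ k * (n - 1) + 1 + t) : ZMod h)) := by
    refine ⟨?_, fun k s _ => ?_⟩
    · rw [show 2 ^ 0 * (n - 1) + 1 + 0 = n by rw [pow_zero]; omega]
      exact (ZMod.natCast_eq_zero_iff _ _).2 h0
    · rw [← add_assoc, a_succ, show (2 ^ (k + 1) * (n - 1) + 1 + s + 1) / 2 =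
        2 ^ k * (n - 1) + 1 + s / 2 by rw [pow_succ, mul_right_comm]; omega]
      push_cast; rfl
  obtain ⟨k, h1, h2, t, ht, hv, he⟩ := hit _ hA
  refine ⟨2 ^ k * (n - 1) + 1 + t, ?_, (ZMod.natCast_eq_zero_iff _ _).1 he, ?_⟩
  · have : 2 ^ 1 * (n - 1) ≤ 2 ^ k * (n - 1) :=
      Nat.mul_le_mul_right _ (Nat.pow_le_pow_right (by norm_num) h1)
    omega
  · rintro rfl
    exact four_valid ht hv _

theorem infinite_of {four : Bool} {h : ℕ} [NeZero h] {D : List ℕ} {R : List (ℕ × ℕ)} (H : Ok h)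
    (hst : (itab h 9).elem 0 = true)
    (hcov : cov four h D R = true) (hR : ∀ p ∈ R, check four h p.1 p.2 = true) (N : ℕ) :
    ∃ n, N < n ∧ h ∣ a n ∧ (four = true → 4 ∣ a n) := by
  have hit := all_hit H hcov hR
  have key : ∀ N, ∃ n, 2 ≤ n ∧ N ≤ n ∧ h ∣ a n := by
    intro N
    induction N with
    | zero =>
      obtain ⟨n, h1, h2⟩ := start (h := h) (by have := H.h7; omega) hst
      exact ⟨n, h1, by omega, h2⟩
    | succ N ih =>
      obtain ⟨n, h1, h2, h3⟩ := ih
      obtain ⟨m, k1, k2, _⟩ := next_zero hit n h1 h3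
      exact ⟨m, by omega, by omega, k2⟩
  obtain ⟨n, h1, h2, h3⟩ := key N
  obtain ⟨m, k1, k2, k3⟩ := next_zero hit n h1 h3
  exact ⟨m, by omega, k2, k3⟩

/-- arbitrarily large even-index values divisible by `h` -/
def Big (h : ℕ) : Prop := ∀ N, ∃ n, N < n ∧ h ∣ a n

theorem Big.inf {h h' : ℕ} (H : Big h) (hd : h' ∣ h) : {n : ℕ | h' ∣ mAryPartitions 2 n}.Infinite := by
  refine Set.infinite_of_forall_exists_gt (fun N => ?_)
  obtain ⟨n, h1, h2⟩ := H N
  exact ⟨2 * n, hd.trans h2, by omega⟩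

theorem big_odd {h : ℕ} {D : List ℕ} {R : List (ℕ × ℕ)} (H : Ok h)
    (hst : (itab h 9).elem 0 = true)
    (hcov : cov false h D R = true) (hR : ∀ p ∈ R, check false h p.1 p.2 = true) : Big h := fun N => by
  have : NeZero h := ⟨by have := H.h7; omega⟩
  obtain ⟨n, h1, h2, _⟩ := infinite_of H hst hcov hR N
  exact ⟨n, h1, h2⟩

theorem big_four {h : ℕ} {D : List ℕ} {R : List (ℕ × ℕ)} (H : Ok h) (hodd : Nat.Coprime 4 h)
    (hst : (itab h 9).elem 0 = true)
    (hcov : cov true h D R = true) (hR : ∀ p ∈ R, check true h p.1 p.2 = true) : Big (4 * h) := fun N => by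
  have : NeZero h := ⟨by have := H.h7; omega⟩
  obtain ⟨n, h1, h2, h3⟩ := infinite_of H hst hcov hR N
  exact ⟨n, h1, hodd.mul_dvd_of_dvd_of_dvd (h3 rfl) h2⟩

end BP

namespace BP

def checks (four : Bool) (h : ℕ) (L : List (ℕ × ℕ)) : Bool := L.all fun p => check four h p.1 p.2

theorem checks_app {four : Bool} {h : ℕ} {L M : List (ℕ × ℕ)} (h1 : checks four h L = true)
    (h2 : checks four h M = true) : checks four h (L ++ M) = true := by
  unfold checks at *
  rw [List.all_append, h1, h2]; rfl

theorem checks_mem {four : Bool} {h : ℕ} {L : List (ℕ × ℕ)} (H : checks four h L = true) :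
    ∀ p ∈ L, check four h p.1 p.2 = true := List.all_eq_true.1 H

set_option maxHeartbeats 0 in
theorem big_all : ∀ H ∈ ([28, 36, 44, 52, 60, 68, 76, 21, 23, 25, 27, 29, 31, 33, 35, 37, 39, 41] : List ℕ), Big H := by
  have chk_28_0 : checks true 7 [(1, 0), (1, 3), (1, 4), (0, 1)] = true := by decide +kernel
  have big_28 : Big 28 := big_four (h := 7) (D := [0, 1]) (by constructor <;> decide +kernel) (by norm_num)
    (by decide +kernel) (by decide +kernel) (checks_mem (chk_28_0))
  have chk_36_0 : checks true 9 [(1, 0), (1, 1), (1, 5), (1, 6), (3, 0), (3, 1), (0, 1), (0, 3)] = true := by decide +kernel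
  have big_36 : Big 36 := big_four (h := 9) (D := [0, 1, 3]) (by constructor <;> decide +kernel) (by norm_num)
    (by decide +kernel) (by decide +kernel) (checks_mem (chk_36_0))
  have chk_44_0 : checks true 11 [(1, 0), (1, 1), (1, 2), (1, 7), (1, 8), (0, 1)] = true := by decide +kernel
  have big_44 : Big 44 := big_four (h := 11) (D := [0, 1]) (by constructor <;> decide +kernel) (by norm_num)
    (by decide +kernel) (by decide +kernel) (checks_mem (chk_44_0))
  have chk_52_0 : checks true 13 [(1, 0), (1, 1), (1, 2), (1, 3), (1, 9), (1, 10), (0, 1)] = true := by decide +kernel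
  have big_52 : Big 52 := big_four (h := 13) (D := [0, 1]) (by constructor <;> decide +kernel) (by norm_num)
    (by decide +kernel) (by decide +kernel) (checks_mem (chk_52_0))
  have chk_60_0 : checks true 15 [(1, 0), (1, 1), (1, 2), (1, 3)] = true := by decide +kernel
  have chk_60_1 : checks true 15 [(1, 4), (1, 11), (1, 12), (3, 1)] = true := by decide +kernel
  have chk_60_2 : checks true 15 [(3, 2), (3, 3), (3, 4)] = true := by decide +kernel
  have chk_60_3 : checks true 15 [(3, 6)] = true := by decide +kernel
  have chk_60_4 : checks true 15 [(5, 0)] = true := by decide +kernel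
  have chk_60_5 : checks true 15 [(5, 1), (5, 3), (0, 1)] = true := by decide +kernel
  have chk_60_6 : checks true 15 [(0, 3)] = true := by decide +kernel
  have chk_60_7 : checks true 15 [(0, 5)] = true := by decide +kernel
  have big_60 : Big 60 := big_four (h := 15) (D := [0, 1, 3, 5]) (by constructor <;> decide +kernel) (by norm_num)
    (by decide +kernel) (by decide +kernel) (checks_mem (checks_app chk_60_0 (checks_app chk_60_1 (checks_app chk_60_2 (checks_app chk_60_3 (checks_app chk_60_4 (checks_app chk_60_5 (checks_app chk_60_6 chk_60_7))))))))
  have chk_68_0 : checks true 17 [(1, 0), (1, 1), (1, 2)] = true := by decide +kernel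
  have chk_68_1 : checks true 17 [(1, 3), (1, 4), (1, 5)] = true := by decide +kernel
  have chk_68_2 : checks true 17 [(1, 13), (1, 14)] = true := by decide +kernel
  have chk_68_3 : checks true 17 [(0, 1)] = true := by decide +kernel
  have big_68 : Big 68 := big_four (h := 17) (D := [0, 1]) (by constructor <;> decide +kernel) (by norm_num)
    (by decide +kernel) (by decide +kernel) (checks_mem (checks_app chk_68_0 (checks_app chk_68_1 (checks_app chk_68_2 chk_68_3))))
  have chk_76_0 : checks true 19 [(1, 0)] = true := by decide +kernel
  have chk_76_1 : checks true 19 [(1, 1)] = true := by decide +kernel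
  have chk_76_2 : checks true 19 [(1, 2)] = true := by decide +kernel
  have chk_76_3 : checks true 19 [(1, 3)] = true := by decide +kernel
  have chk_76_4 : checks true 19 [(1, 4)] = true := by decide +kernel
  have chk_76_5 : checks true 19 [(1, 5)] = true := by decide +kernel
  have chk_76_6 : checks true 19 [(1, 6)] = true := by decide +kernel
  have chk_76_7 : checks true 19 [(1, 15)] = true := by decide +kernel
  have chk_76_8 : checks true 19 [(1, 16)] = true := by decide +kernel
  have chk_76_9 : checks true 19 [(0, 1)] = true := by decide +kernel
  have big_76 : Big 76 := big_four (h := 19) (D := [0, 1]) (by constructor <;> decide +kernel) (by norm_num)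
    (by decide +kernel) (by decide +kernel) (checks_mem (checks_app chk_76_0 (checks_app chk_76_1 (checks_app chk_76_2 (checks_app chk_76_3 (checks_app chk_76_4 (checks_app chk_76_5 (checks_app chk_76_6 (checks_app chk_76_7 (checks_app chk_76_8 chk_76_9))))))))))
  have chk_21_0 : checks false 21 [(1, 1), (1, 2), (1, 3), (1, 4), (1, 5), (1, 6), (1, 7), (3, 1), (3, 4), (3, 5), (3, 7), (7, 1), (7, 3)] = true := by decide +kernel
  have big_21 : Big 21 := big_odd (D := [1, 3, 7]) (by constructor <;> decide +kernel)
    (by decide +kernel) (by decide +kernel) (checks_mem (chk_21_0))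
  have chk_23_0 : checks false 23 [(1, 1), (1, 2), (1, 3), (1, 4), (1, 5), (1, 6), (1, 7), (1, 8)] = true := by decide +kernel
  have big_23 : Big 23 := big_odd (D := [1]) (by constructor <;> decide +kernel)
    (by decide +kernel) (by decide +kernel) (checks_mem (chk_23_0))
  have chk_25_0 : checks false 25 [(1, 1), (1, 2), (1, 3), (1, 4), (1, 5), (1, 6), (1, 7), (1, 8), (1, 9), (5, 1), (5, 2)] = true := by decide +kernel
  have big_25 : Big 25 := big_odd (D := [1, 5]) (by constructor <;> decide +kernel)
    (by decide +kernel) (by decide +kernel) (checks_mem (chk_25_0))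
  have chk_27_0 : checks false 27 [(1, 1), (1, 2), (1, 3), (1, 4), (1, 5), (1, 6), (1, 7), (1, 8), (1, 9), (1, 10), (3, 1), (3, 2)] = true := by decide +kernel
  have chk_27_1 : checks false 27 [(3, 3), (3, 4), (9, 1), (9, 3)] = true := by decide +kernel
  have big_27 : Big 27 := big_odd (D := [1, 3, 9]) (by constructor <;> decide +kernel)
    (by decide +kernel) (by decide +kernel) (checks_mem (checks_app chk_27_0 chk_27_1))
  have chk_29_0 : checks false 29 [(1, 1), (1, 2), (1, 3), (1, 4), (1, 5), (1, 6), (1, 7)] = true := by decide +kernel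
  have chk_29_1 : checks false 29 [(1, 8), (1, 9), (1, 10), (1, 11)] = true := by decide +kernel
  have big_29 : Big 29 := big_odd (D := [1]) (by constructor <;> decide +kernel)
    (by decide +kernel) (by decide +kernel) (checks_mem (checks_app chk_29_0 chk_29_1))
  have chk_31_0 : checks false 31 [(1, 1), (1, 2), (1, 3), (1, 4)] = true := by decide +kernel
  have chk_31_1 : checks false 31 [(1, 5), (1, 6), (1, 7), (1, 8)] = true := by decide +kernel
  have chk_31_2 : checks false 31 [(1, 9), (1, 10), (1, 11)] = true := by decide +kernel
  have chk_31_3 : checks false 31 [(1, 12)] = true := by decide +kernel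
  have big_31 : Big 31 := big_odd (D := [1]) (by constructor <;> decide +kernel)
    (by decide +kernel) (by decide +kernel) (checks_mem (checks_app chk_31_0 (checks_app chk_31_1 (checks_app chk_31_2 chk_31_3))))
  have chk_33_0 : checks false 33 [(1, 1), (1, 2)] = true := by decide +kernel
  have chk_33_1 : checks false 33 [(1, 3), (1, 4)] = true := by decide +kernel
  have chk_33_2 : checks false 33 [(1, 5), (1, 6), (1, 7)] = true := by decide +kernel
  have chk_33_3 : checks false 33 [(1, 8), (1, 9)] = true := by decide +kernel
  have chk_33_4 : checks false 33 [(1, 10), (1, 11)] = true := by decide +kernel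
  have chk_33_5 : checks false 33 [(1, 12), (1, 13)] = true := by decide +kernel
  have chk_33_6 : checks false 33 [(3, 1), (3, 2)] = true := by decide +kernel
  have chk_33_7 : checks false 33 [(3, 3)] = true := by decide +kernel
  have chk_33_8 : checks false 33 [(3, 4), (3, 5)] = true := by decide +kernel
  have chk_33_9 : checks false 33 [(3, 6)] = true := by decide +kernel
  have chk_33_10 : checks false 33 [(3, 7), (3, 17)] = true := by decide +kernel
  have chk_33_11 : checks false 33 [(11, 1)] = true := by decide +kernel
  have chk_33_12 : checks false 33 [(11, 3)] = true := by decide +kernel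
  have big_33 : Big 33 := big_odd (D := [1, 3, 11]) (by constructor <;> decide +kernel)
    (by decide +kernel) (by decide +kernel) (checks_mem (checks_app chk_33_0 (checks_app chk_33_1 (checks_app chk_33_2 (checks_app chk_33_3 (checks_app chk_33_4 (checks_app chk_33_5 (checks_app chk_33_6 (checks_app chk_33_7 (checks_app chk_33_8 (checks_app chk_33_9 (checks_app chk_33_10 (checks_app chk_33_11 chk_33_12)))))))))))))
  have chk_35_0 : checks false 35 [(1, 1)] = true := by decide +kernel
  have chk_35_1 : checks false 35 [(1, 2)] = true := by decide +kernel
  have chk_35_2 : checks false 35 [(1, 3)] = true := by decide +kernel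
  have chk_35_3 : checks false 35 [(1, 4)] = true := by decide +kernel
  have chk_35_4 : checks false 35 [(1, 5)] = true := by decide +kernel
  have chk_35_5 : checks false 35 [(1, 6)] = true := by decide +kernel
  have chk_35_6 : checks false 35 [(1, 7)] = true := by decide +kernel
  have chk_35_7 : checks false 35 [(1, 8)] = true := by decide +kernel
  have chk_35_8 : checks false 35 [(1, 9)] = true := by decide +kernel
  have chk_35_9 : checks false 35 [(1, 10)] = true := by decide +kernel
  have chk_35_10 : checks false 35 [(1, 11)] = true := by decide +kernel
  have chk_35_11 : checks false 35 [(1, 12)] = true := by decide +kernel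
  have chk_35_12 : checks false 35 [(1, 13)] = true := by decide +kernel
  have chk_35_13 : checks false 35 [(1, 14)] = true := by decide +kernel
  have chk_35_14 : checks false 35 [(5, 1)] = true := by decide +kernel
  have chk_35_15 : checks false 35 [(5, 2)] = true := by decide +kernel
  have chk_35_16 : checks false 35 [(5, 6)] = true := by decide +kernel
  have chk_35_17 : checks false 35 [(5, 7)] = true := by decide +kernel
  have chk_35_18 : checks false 35 [(7, 1)] = true := by decide +kernel
  have chk_35_19 : checks false 35 [(7, 3)] = true := by decide +kernel
  have chk_35_20 : checks false 35 [(7, 4)] = true := by decide +kernel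
  have big_35 : Big 35 := big_odd (D := [1, 5, 7]) (by constructor <;> decide +kernel)
    (by decide +kernel) (by decide +kernel) (checks_mem (checks_app chk_35_0 (checks_app chk_35_1 (checks_app chk_35_2 (checks_app chk_35_3 (checks_app chk_35_4 (checks_app chk_35_5 (checks_app chk_35_6 (checks_app chk_35_7 (checks_app chk_35_8 (checks_app chk_35_9 (checks_app chk_35_10 (checks_app chk_35_11 (checks_app chk_35_12 (checks_app chk_35_13 (checks_app chk_35_14 (checks_app chk_35_15 (checks_app chk_35_16 (checks_app chk_35_17 (checks_app chk_35_18 (checks_app chk_35_19 chk_35_20)))))))))))))))))))))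
  have chk_37_0 : checks false 37 [(1, 1)] = true := by decide +kernel
  have chk_37_1 : checks false 37 [(1, 2)] = true := by decide +kernel
  have chk_37_2 : checks false 37 [(1, 3)] = true := by decide +kernel
  have chk_37_3 : checks false 37 [(1, 4)] = true := by decide +kernel
  have chk_37_4 : checks false 37 [(1, 5)] = true := by decide +kernel
  have chk_37_5 : checks false 37 [(1, 6)] = true := by decide +kernel
  have chk_37_6 : checks false 37 [(1, 7)] = true := by decide +kernel
  have chk_37_7 : checks false 37 [(1, 8)] = true := by decide +kernel
  have chk_37_8 : checks false 37 [(1, 9)] = true := by decide +kernel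
  have chk_37_9 : checks false 37 [(1, 10)] = true := by decide +kernel
  have chk_37_10 : checks false 37 [(1, 11)] = true := by decide +kernel
  have chk_37_11 : checks false 37 [(1, 12)] = true := by decide +kernel
  have chk_37_12 : checks false 37 [(1, 13)] = true := by decide +kernel
  have chk_37_13 : checks false 37 [(1, 14)] = true := by decide +kernel
  have chk_37_14 : checks false 37 [(1, 15)] = true := by decide +kernel
  have big_37 : Big 37 := big_odd (D := [1]) (by constructor <;> decide +kernel)
    (by decide +kernel) (by decide +kernel) (checks_mem (checks_app chk_37_0 (checks_app chk_37_1 (checks_app chk_37_2 (checks_app chk_37_3 (checks_app chk_37_4 (checks_app chk_37_5 (checks_app chk_37_6 (checks_app chk_37_7 (checks_app chk_37_8 (checks_app chk_37_9 (checks_app chk_37_10 (checks_app chk_37_11 (checks_app chk_37_12 (checks_app chk_37_13 chk_37_14)))))))))))))))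
  have chk_39_0 : checks false 39 [(1, 1)] = true := by decide +kernel
  have chk_39_1 : checks false 39 [(1, 2)] = true := by decide +kernel
  have chk_39_2 : checks false 39 [(1, 3)] = true := by decide +kernel
  have chk_39_3 : checks false 39 [(1, 4)] = true := by decide +kernel
  have chk_39_4 : checks false 39 [(1, 5)] = true := by decide +kernel
  have chk_39_5 : checks false 39 [(1, 6)] = true := by decide +kernel
  have chk_39_6 : checks false 39 [(1, 7)] = true := by decide +kernel
  have chk_39_7 : checks false 39 [(1, 8)] = true := by decide +kernel
  have chk_39_8 : checks false 39 [(1, 9)] = true := by decide +kernel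
  have chk_39_9 : checks false 39 [(1, 10)] = true := by decide +kernel
  have chk_39_10 : checks false 39 [(1, 11)] = true := by decide +kernel
  have chk_39_11 : checks false 39 [(1, 12)] = true := by decide +kernel
  have chk_39_12 : checks false 39 [(1, 13)] = true := by decide +kernel
  have chk_39_13 : checks false 39 [(1, 14)] = true := by decide +kernel
  have chk_39_14 : checks false 39 [(1, 15)] = true := by decide +kernel
  have chk_39_15 : checks false 39 [(1, 16)] = true := by decide +kernel
  have chk_39_16 : checks false 39 [(3, 1)] = true := by decide +kernel
  have chk_39_17 : checks false 39 [(3, 2)] = true := by decide +kernel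
  have chk_39_18 : checks false 39 [(3, 3)] = true := by decide +kernel
  have chk_39_19 : checks false 39 [(3, 4)] = true := by decide +kernel
  have chk_39_20 : checks false 39 [(3, 5)] = true := by decide +kernel
  have chk_39_21 : checks false 39 [(3, 6)] = true := by decide +kernel
  have chk_39_22 : checks false 39 [(3, 8)] = true := by decide +kernel
  have chk_39_23 : checks false 39 [(3, 9)] = true := by decide +kernel
  have chk_39_24 : checks false 39 [(3, 10)] = true := by decide +kernel
  have chk_39_25 : checks false 39 [(3, 22)] = true := by decide +kernel
  have chk_39_26 : checks false 39 [(13, 1)] = true := by decide +kernel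
  have chk_39_27 : checks false 39 [(13, 3)] = true := by decide +kernel
  have big_39 : Big 39 := big_odd (D := [1, 3, 13]) (by constructor <;> decide +kernel)
    (by decide +kernel) (by decide +kernel) (checks_mem (checks_app chk_39_0 (checks_app chk_39_1 (checks_app chk_39_2 (checks_app chk_39_3 (checks_app chk_39_4 (checks_app chk_39_5 (checks_app chk_39_6 (checks_app chk_39_7 (checks_app chk_39_8 (checks_app chk_39_9 (checks_app chk_39_10 (checks_app chk_39_11 (checks_app chk_39_12 (checks_app chk_39_13 (checks_app chk_39_14 (checks_app chk_39_15 (checks_app chk_39_16 (checks_app chk_39_17 (checks_app chk_39_18 (checks_app chk_39_19 (checks_app chk_39_20 (checks_app chk_39_21 (checks_app chk_39_22 (checks_app chk_39_23 (checks_app chk_39_24 (checks_app chk_39_25 (checks_app chk_39_26 chk_39_27))))))))))))))))))))))))))))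
  have chk_41_0 : checks false 41 [(1, 1)] = true := by decide +kernel
  have chk_41_1 : checks false 41 [(1, 2)] = true := by decide +kernel
  have chk_41_2 : checks false 41 [(1, 3)] = true := by decide +kernel
  have chk_41_3 : checks false 41 [(1, 4)] = true := by decide +kernel
  have chk_41_4 : checks false 41 [(1, 5)] = true := by decide +kernel
  have chk_41_5 : checks false 41 [(1, 6)] = true := by decide +kernel
  have chk_41_6 : checks false 41 [(1, 7)] = true := by decide +kernel
  have chk_41_7 : checks false 41 [(1, 8)] = true := by decide +kernel
  have chk_41_8 : checks false 41 [(1, 9)] = true := by decide +kernel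
  have chk_41_9 : checks false 41 [(1, 10)] = true := by decide +kernel
  have chk_41_10 : checks false 41 [(1, 11)] = true := by decide +kernel
  have chk_41_11 : checks false 41 [(1, 12)] = true := by decide +kernel
  have chk_41_12 : checks false 41 [(1, 13)] = true := by decide +kernel
  have chk_41_13 : checks false 41 [(1, 14)] = true := by decide +kernel
  have chk_41_14 : checks false 41 [(1, 15)] = true := by decide +kernel
  have chk_41_15 : checks false 41 [(1, 16)] = true := by decide +kernel
  have chk_41_16 : checks false 41 [(1, 17)] = true := by decide +kernel
  have big_41 : Big 41 := big_odd (D := [1]) (by constructor <;> decide +kernel)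
    (by decide +kernel) (by decide +kernel) (checks_mem (checks_app chk_41_0 (checks_app chk_41_1 (checks_app chk_41_2 (checks_app chk_41_3 (checks_app chk_41_4 (checks_app chk_41_5 (checks_app chk_41_6 (checks_app chk_41_7 (checks_app chk_41_8 (checks_app chk_41_9 (checks_app chk_41_10 (checks_app chk_41_11 (checks_app chk_41_12 (checks_app chk_41_13 (checks_app chk_41_14 (checks_app chk_41_15 chk_41_16)))))))))))))))))
  simp only [List.forall_mem_cons]
  exact ⟨big_28, big_36, big_44, big_52, big_60, big_68, big_76, big_21, big_23, big_25, big_27, big_29, big_31, big_33, big_35, big_37, big_39, big_41, by simp⟩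

theorem reduce : ∀ h < 42, 3 ≤ h → ¬ 8 ∣ h → ∃ H ∈ ([28, 36, 44, 52, 60, 68, 76, 21, 23, 25, 27, 29, 31, 33, 35, 37, 39, 41] : List ℕ), h ∣ H := by
  decide +kernel

end BP


/-- Theorem 7 (twcom) of the paper. -/
theorem stmt_6 :
    ∀ h : ℕ, ((3 ≤ h ∧ h ≤ 41 ∧ ¬ 8 ∣ h) ∨ h ∈ ({44, 52, 60, 68, 76} : Set ℕ)) →
      {n : ℕ | h ∣ mAryPartitions 2 n}.Infinite := by
  rintro h (⟨h1, h2, h3⟩ | hh)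
  · obtain ⟨H, hm, hd⟩ := BP.reduce h (by omega) h1 h3
    exact (BP.big_all H hm).inf hd
  · simp only [Set.mem_insert_iff, Set.mem_singleton_iff] at hh
    rcases hh with rfl | rfl | rfl | rfl | rfl
    · exact (BP.big_all 44 (by simp)).inf dvd_rfl
    · exact (BP.big_all 52 (by simp)).inf dvd_rfl
    · exact (BP.big_all 60 (by simp)).inf dvd_rfl
    · exact (BP.big_all 68 (by simp)).inf dvd_rfl
    · exact (BP.big_all 76 (by simp)).inf dvd_rfl
end

section
/- Let m ≥ 2 and let h be a natural number with 2 < h ≤ m + 1. Then every residue class modulo h appears infinitely many times in the sequence (b_m(n) mod h)_{n≥0}, and every residue class modulo h appears infinitely many times in the sequence (c_m(n) mod h)_{n≥0}. Moreover, if h is odd and 2 < h ≤ m, then every residue class modulo h appears infinitely many times in the sequence (ovb_m(n) mod h)_{n≥0}. -/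
/-- The number of `m`-ary partitions of `n` with no gaps. -/
noncomputable def mAryPartitionsNoGaps (m n : ℕ) : ℕ :=
  Nat.card {f : ℕ →₀ ℕ // (f.sum fun i c => c * m ^ i) = n ∧
    ∀ j : ℕ, 1 ≤ j → 0 < f j → 0 < f (j - 1)}

namespace MAry

/-- Progression engine: a sequence containing long arithmetic progressions with unit difference
hits everything infinitely often. -/
theorem engine {h : ℕ} (hh : 2 < h) (a : ℕ → ZMod h) (s : ℕ → ℕ) (u : ZMod h) (hu : IsUnit u)
    (k0 : ℕ) (hk0 : IsUnit (a k0)) (hs : ∀ k, k0 ≤ k → k ≤ s k)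
    (hap : ∀ k, k0 ≤ k → ∀ t, t < h → a (s k + t) = a (s k) + t * (u * a k)) :
    ∀ (c : ZMod h) (N : ℕ), ∃ n, N ≤ n ∧ a n = c := by
  have : NeZero h := ⟨by omega⟩
  have : Fact (2 < h) := ⟨hh⟩
  have hit : ∀ k, k0 ≤ k → IsUnit (a k) → ∀ c, ∃ n, k ≤ n ∧ a n = c := by
    intro k hk hak c
    obtain ⟨v, hv⟩ := hu.mul hak
    refine ⟨s k + ((c - a (s k)) * (v⁻¹ : (ZMod h)ˣ)).val, by have := hs k hk; omega, ?_⟩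
    rw [hap k hk _ (ZMod.val_lt _), ZMod.natCast_zmod_val, ← hv, mul_assoc]
    simp
  have big : ∀ N, ∃ k, N ≤ k ∧ k0 ≤ k ∧ IsUnit (a k) := by
    intro N
    induction N with
    | zero => exact ⟨k0, by omega, le_rfl, hk0⟩
    | succ N ih =>
      obtain ⟨k, h1, h2, h3⟩ := ih
      obtain ⟨n, hn, hc⟩ := hit k h2 h3 (-a k)
      have hne : n ≠ k := by
        rintro rfl
        obtain ⟨v, hv⟩ := h3
        rw [← hv] at hc
        have h5 : (1 : ZMod h) = -1 := by
          have := congrArg (· * ((v⁻¹ : (ZMod h)ˣ) : ZMod h)) hc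
          simpa using this
        exact ZMod.neg_one_ne_one h5.symm
      exact ⟨n, by omega, by omega, by rw [hc]; exact h3.neg⟩
  intro c N
  obtain ⟨k, h1, h2, h3⟩ := big N
  obtain ⟨n, hn, hc⟩ := hit k h2 h3 c
  exact ⟨n, by omega, hc⟩

/-- weight -/
noncomputable def wt (m : ℕ) (f : ℕ →₀ ℕ) : ℕ := f.sum fun i c => c * m ^ i

noncomputable def tl (f : ℕ →₀ ℕ) : ℕ →₀ ℕ :=
  Finsupp.comapDomain Nat.succ f (Nat.succ_injective.injOn)

noncomputable def cns (a : ℕ) (g : ℕ →₀ ℕ) : ℕ →₀ ℕ :=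
  Finsupp.single 0 a + Finsupp.mapDomain Nat.succ g

theorem tl_apply (f : ℕ →₀ ℕ) (i : ℕ) : tl f i = f (i + 1) := rfl

theorem cns_zero (a : ℕ) (g : ℕ →₀ ℕ) : cns a g 0 = a := by
  have : Finsupp.mapDomain Nat.succ g 0 = 0 := by
    apply Finsupp.mapDomain_of_notMem_range
    simp
  simp [cns, this]

theorem cns_succ (a : ℕ) (g : ℕ →₀ ℕ) (i : ℕ) : cns a g (i + 1) = g i := by
  have : Finsupp.mapDomain Nat.succ g (Nat.succ i) = g i :=
    Finsupp.mapDomain_apply Nat.succ_injective g i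
  simp only [cns, Finsupp.add_apply]
  rw [Finsupp.single_eq_of_ne (by omega)]
  simpa using this

theorem tl_cns (a : ℕ) (g : ℕ →₀ ℕ) : tl (cns a g) = g := by
  ext i; rw [tl_apply, cns_succ]

theorem cns_tl (f : ℕ →₀ ℕ) : cns (f 0) (tl f) = f := by
  ext i
  cases i with
  | zero => rw [cns_zero]
  | succ i => rw [cns_succ, tl_apply]

theorem wt_cns (m a : ℕ) (g : ℕ →₀ ℕ) : wt m (cns a g) = a + m * wt m g := by
  unfold wt cns
  rw [Finsupp.sum_add_index' (by simp) (by intros; ring), Finsupp.sum_single_index (by simp),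
    Finsupp.sum_mapDomain_index (by simp) (by intros; ring)]
  simp only [pow_zero, mul_one, Finsupp.sum, Finset.mul_sum]
  congr 1
  apply Finset.sum_congr rfl
  intro i _
  rw [Nat.succ_eq_add_one]; ring

theorem wt_eq (m : ℕ) (f : ℕ →₀ ℕ) : wt m f = f 0 + m * wt m (tl f) := by
  conv_lhs => rw [← cns_tl f]
  rw [wt_cns]

theorem le_wt (m : ℕ) (f : ℕ →₀ ℕ) (i : ℕ) : f i * m ^ i ≤ wt m f := by
  unfold wt Finsupp.sum
  by_cases hi : i ∈ f.support
  · exact Finset.single_le_sum (f := fun i => f i * m ^ i) (fun _ _ => Nat.zero_le _) hi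
  · simp [Finsupp.notMem_support_iff.mp hi]

theorem fin_lt {m : ℕ} (hm : 2 ≤ m) (K : ℕ) : {f : ℕ →₀ ℕ | wt m f < K}.Finite := by
  refine (Set.finite_Icc (0 : ℕ →₀ ℕ) (∑ i ∈ Finset.range K, Finsupp.single i K)).subset ?_
  intro f hf
  refine ⟨zero_le, ?_⟩
  intro i
  have h1 := le_wt m f i
  have h2 : i < m ^ i := Nat.lt_pow_self (by omega)
  have hf' : wt m f < K := hf
  rw [Finsupp.finsetSum_apply]
  by_cases h0 : f i = 0
  · rw [h0]; exact Nat.zero_le _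
  · have hi : i < K := by nlinarith [Nat.pos_of_ne_zero h0]
    have : f i ≤ K := by nlinarith
    refine this.trans ?_
    have := Finset.single_le_sum (f := fun j => (Finsupp.single j K : ℕ →₀ ℕ) i)
      (fun _ _ => Nat.zero_le _) (Finset.mem_range.mpr hi)
    simpa using this

theorem wt_zero_iff {m : ℕ} (hm : 2 ≤ m) (f : ℕ →₀ ℕ) : wt m f = 0 ↔ f = 0 := by
  constructor
  · intro h
    ext i
    have h1 := le_wt m f i
    have h2 : 0 < m ^ i := by positivity
    rw [h] at h1
    simpa using (mul_eq_zero.mp (Nat.le_zero.mp h1)).resolve_right h2.ne'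
  · rintro rfl; simp [wt]

/-- cumulative count -/
noncomputable def cum (P : (ℕ →₀ ℕ) → Prop) (m n : ℕ) : ℕ :=
  {f : ℕ →₀ ℕ | wt m f < n + 1 ∧ P f}.ncard

theorem cum_zero {m : ℕ} (hm : 2 ≤ m) (P : (ℕ →₀ ℕ) → Prop) (h0 : P 0) : cum P m 0 = 1 := by
  unfold cum
  rw [Set.ncard_eq_one]
  refine ⟨0, ?_⟩
  ext f
  simp only [Set.mem_ofPred_eq, Set.mem_singleton_iff, zero_add, Nat.lt_one_iff, wt_zero_iff hm]
  constructor
  · exact fun h => h.1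
  · rintro rfl; exact ⟨rfl, h0⟩

theorem cum_succ {m : ℕ} (hm : 2 ≤ m) (P : (ℕ →₀ ℕ) → Prop) (n : ℕ) :
    cum P m (n + 1) = cum P m n + {f : ℕ →₀ ℕ | wt m f = n + 1 ∧ P f}.ncard := by
  unfold cum
  rw [← Set.ncard_union_eq (hs := ?_) (ht := ?_)]
  · congr 1
    ext f
    simp only [Set.mem_ofPred_eq, Set.mem_union]
    rw [← or_and_right]
    refine and_congr_left fun _ => ?_
    omega
  · rw [Set.disjoint_left]
    rintro f ⟨h1, _⟩ ⟨h2, _⟩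
    omega
  · exact (fin_lt hm (n + 1)).subset fun f hf => hf.1
  · exact (fin_lt hm (n + 2)).subset fun f hf => by
      have := hf.1
      simp only [Set.mem_ofPred_eq]; omega

theorem card_eq_cum {m : ℕ} (P : (ℕ →₀ ℕ) → Prop) (n K : ℕ)
    (hK : m * K ≤ n)
    (hP : ∀ f, wt m f = n → (P f ↔ P (tl f) ∧ wt m (tl f) < K + 1)) :
    {f : ℕ →₀ ℕ | wt m f = n ∧ P f}.ncard = cum P m K := by
  unfold cum
  refine Set.ncard_congr (fun f _ => tl f) ?_ ?_ ?_
  · rintro f ⟨h1, h2⟩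
    exact ((hP f h1).mp h2).symm
  · rintro f g ⟨h1, _⟩ ⟨h2, _⟩ h
    have e1 := wt_eq m f
    have e2 := wt_eq m g
    rw [h] at e1
    rw [← cns_tl f, ← cns_tl g, h]
    congr 1
    omega
  · rintro g ⟨h1, h2⟩
    have hw : wt m (cns (n - m * wt m g) g) = n := by
      rw [wt_cns]
      have : m * wt m g ≤ m * K := Nat.mul_le_mul_left _ (by omega)
      omega
    refine ⟨cns (n - m * wt m g) g, ⟨hw, ?_⟩, tl_cns _ _⟩
    rw [hP _ hw, tl_cns]
    exact ⟨h2, h1⟩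

theorem b_eq {m : ℕ} (hm : 2 ≤ m) (n : ℕ) :
    {f : ℕ →₀ ℕ | wt m f = n ∧ True}.ncard = cum (fun _ => True) m (n / m) := by
  refine card_eq_cum (fun _ => True) n (n / m) (Nat.mul_div_le n m) ?_
  intro f hf
  have e1 := wt_eq m f
  simp only [true_iff, true_and]
  rw [Nat.lt_succ_iff, Nat.le_div_iff_mul_le (by omega)]
  rw [mul_comm]; omega

def NG (f : ℕ →₀ ℕ) : Prop := ∀ j : ℕ, 1 ≤ j → 0 < f j → 0 < f (j - 1)

theorem ng_tl {f : ℕ →₀ ℕ} : NG f ↔ NG (tl f) ∧ (0 < tl f 0 → 0 < f 0) := by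
  constructor
  · intro h
    refine ⟨fun j hj hp => ?_, fun hp => h 1 le_rfl hp⟩
    have := h (j + 1) (by omega) hp
    rw [tl_apply]
    rwa [show j - 1 + 1 = j + 1 - 1 by omega]
  · rintro ⟨h1, h2⟩ j hj hp
    obtain ⟨j, rfl⟩ : ∃ i, j = i + 1 := ⟨j - 1, by omega⟩
    cases j with
    | zero => exact h2 hp
    | succ j =>
      have := h1 (j + 1) (by omega) hp
      simpa [tl_apply] using this

theorem ng_zero {f : ℕ →₀ ℕ} (h : NG f) (h0 : f 0 = 0) : f = 0 := by
  ext i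
  induction i with
  | zero => simpa using h0
  | succ i ih =>
    by_contra hne
    have := h (i + 1) (by omega) (Nat.pos_of_ne_zero hne)
    simp at this ih
    omega

theorem c_eq {m : ℕ} (hm : 2 ≤ m) (n : ℕ) :
    {f : ℕ →₀ ℕ | wt m f = n + 1 ∧ NG f}.ncard = cum NG m (n / m) := by
  refine card_eq_cum NG (n + 1) (n / m) ((Nat.mul_div_le n m).trans (by omega)) ?_
  intro f hf
  have e1 := wt_eq m f
  rw [ng_tl]
  refine and_congr_right fun hng => ?_
  rw [Nat.lt_succ_iff, Nat.le_div_iff_mul_le (by omega), mul_comm]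
  constructor
  · intro h
    by_cases h0 : tl f 0 = 0
    · have := ng_zero hng h0
      have : wt m (tl f) = 0 := (wt_zero_iff hm _).mpr this
      rw [this]; omega
    · have := h (Nat.pos_of_ne_zero h0)
      omega
  · intro h _
    omega

theorem infinite_of {h : ℕ} {a : ℕ → ZMod h} {S : Set ℕ} (g : ℕ → ℕ) (hg : ∀ n, n ≤ g n)
    (c : ZMod h) (H : ∀ N : ℕ, ∃ n, N ≤ n ∧ a n = c) (hS : ∀ n, a n = c → g n ∈ S) :
    S.Infinite := by
  rw [Set.infinite_iff_exists_gt]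
  intro N
  obtain ⟨n, h1, h2⟩ := H (N + 1)
  exact ⟨g n, hS n h2, by have := hg n; omega⟩

end MAry

open MAry

/-- Corollary 2 of the paper. `ov` is the sequence `ovb_m`. -/
theorem stmt_9 (m : ℕ) (hm : 2 ≤ m) (h : ℕ) (hh : 2 < h)
    (ov : ℕ → ℤ) (hov0 : ov 0 = 1)
    (hovflat : ∀ n : ℕ, ∀ j : ℕ, j < m → ov (m * n + j) = ov (m * n))
    (hovrec : ∀ n : ℕ, 1 ≤ n → ov (m * n) - ov (m * n - 1) = ov n + ov (n - 1)) :
    (h ≤ m + 1 →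
      (∀ c : ℕ, {n : ℕ | mAryPartitions m n ≡ c [MOD h]}.Infinite) ∧
      (∀ c : ℕ, {n : ℕ | mAryPartitionsNoGaps m n ≡ c [MOD h]}.Infinite)) ∧
    (Odd h → h ≤ m →
      ∀ c : ℤ, {n : ℕ | ov n ≡ c [ZMOD (h : ℤ)]}.Infinite) := by
  have hle : ∀ n, n ≤ m * n := fun n => Nat.le_mul_of_pos_left n (by omega)
  refine ⟨fun hhm => ⟨fun c => ?_, fun c => ?_⟩, fun hodd hhm c => ?_⟩
  · -- ordinary partitions
    set C : ℕ → ℕ := cum (fun _ => True) m with hC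
    have hC0 : C 0 = 1 := cum_zero hm _ trivial
    have hCs : ∀ n, C (n + 1) = C n + C ((n + 1) / m) := by
      intro n
      rw [hC, cum_succ hm, b_eq hm]
    have hb : ∀ n, mAryPartitions m n = C (n / m) := by
      intro n
      rw [hC, ← b_eq hm n]
      simp only [and_true]
      rfl
    have hsmall : ∀ i, i < m → C i = i + 1 := by
      intro i
      induction i with
      | zero => intro _; exact hC0
      | succ i ih =>
        intro hi
        rw [hCs, ih (by omega), Nat.div_eq_of_lt hi, hC0]
    have hap : ∀ k, 1 ≤ k → ∀ t, t ≤ m → C (m * k - 1 + t) = C (m * k - 1) + t * C k := by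
      intro k hk t
      induction t with
      | zero => intro _; simp
      | succ t ih =>
        intro ht
        have := hle k
        rw [← add_assoc, hCs, ih (by omega), show m * k - 1 + t + 1 = t + m * k by omega,
          Nat.add_mul_div_left _ _ (by omega), Nat.div_eq_of_lt (by omega), zero_add]
        ring
    refine infinite_of (a := fun n => (C n : ZMod h)) (fun n => m * n) hle (c : ZMod h)
      (engine hh _ (fun k => m * k - 1) 1 isUnit_one (h - 2) ?_ ?_ ?_ _) ?_
    · rw [hsmall _ (by omega), show h - 2 + 1 = h - 1 by omega, Nat.cast_sub (by omega)]
      simp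
    · intro k hk
      have : 2 * k ≤ m * k := Nat.mul_le_mul_right _ hm
      show k ≤ m * k - 1
      omega
    · intro k hk t ht
      show (C (m * k - 1 + t) : ZMod h) = _
      rw [hap k (by omega) t (by omega)]
      push_cast; ring
    · intro n hn
      show mAryPartitions m (m * n) ≡ c [MOD h]
      rw [hb, Nat.mul_div_cancel_left _ (by omega)]
      exact (ZMod.natCast_eq_natCast_iff _ _ _).mp hn
  · -- no gaps
    set C : ℕ → ℕ := cum NG m with hC
    have hC0 : C 0 = 1 := cum_zero hm _ (by intro j; simp)
    have hCs : ∀ n, C (n + 1) = C n + C (n / m) := by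
      intro n
      rw [hC, cum_succ hm, c_eq hm]
    have hb : ∀ n, mAryPartitionsNoGaps m (n + 1) = C (n / m) := by
      intro n
      rw [hC, ← c_eq hm n]
      rfl
    have hap : ∀ k, ∀ t, t ≤ m → C (m * k + t) = C (m * k) + t * C k := by
      intro k t
      induction t with
      | zero => intro _; simp
      | succ t ih =>
        intro ht
        rw [← add_assoc, hCs, ih (by omega), Nat.mul_add_div (by omega),
          Nat.div_eq_of_lt (by omega), add_zero]
        ring
    refine infinite_of (a := fun n => (C n : ZMod h)) (fun n => m * n + 1)
      (fun n => (hle n).trans (Nat.le_succ _)) (c : ZMod h)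
      (engine hh _ (fun k => m * k) 1 isUnit_one 0 ?_ (fun k _ => hle k) ?_ _) ?_
    · simp [hC0]
    · intro k hk t ht
      show (C (m * k + t) : ZMod h) = _
      rw [hap k t (by omega)]
      push_cast; ring
    · intro n hn
      show mAryPartitionsNoGaps m (m * n + 1) ≡ c [MOD h]
      rw [hb, Nat.mul_div_cancel_left _ (by omega)]
      exact (ZMod.natCast_eq_natCast_iff _ _ _).mp hn
  · -- overpartitions
    have hap : ∀ k, ∀ t, t < m → ov (m * (m * k + t)) = ov (m * (m * k)) + t * (2 * ov (m * k)) := by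
      intro k t
      induction t with
      | zero => intro _; simp
      | succ t ih =>
        intro ht
        have h1 := hovrec (m * k + (t + 1)) (by omega)
        have h2 : m * (m * k + (t + 1)) - 1 = m * (m * k + t) + (m - 1) := by
          have : m * (m * k + (t + 1)) = m * (m * k + t) + m := by ring
          omega
        rw [h2, hovflat _ _ (by omega), hovflat k _ ht,
          show m * k + (t + 1) - 1 = m * k + t by omega, hovflat k t (by omega),
          ih (by omega)] at h1
        push_cast
        linarith
    refine infinite_of (a := fun n => (ov (m * n) : ZMod h)) (fun n => m * n) hle (c : ZMod h)
      (engine hh _ (fun k => m * k) 2 ?_ 0 ?_ (fun k _ => hle k) ?_ _) ?_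
    · have := (ZMod.isUnit_iff_coprime 2 h).mpr (Nat.coprime_two_left.mpr hodd)
      simpa using this
    · simp [hov0]
    · intro k hk t ht
      show (ov (m * (m * k + t)) : ZMod h) = _
      rw [hap k t (by omega)]
      push_cast; ring
    · intro n hn
      exact (ZMod.intCast_eq_intCast_iff _ _ _).mp hn
end

section
/- Let m ≥ 2 and let p be a prime with 3 < p ≤ m² + m + 1. If there exists n₁ such that b_m(n₁) ≡ 0 (mod p), then the congruence b_m(n) ≡ 0 (mod p) has infinitely many solutions n ∈ ℕ. -/
/-- weight of a representation -/
noncomputable def wt10 (m : ℕ) (f : ℕ →₀ ℕ) : ℕ := f.sum fun i c => c * m ^ i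

/-- shift of a representation -/
noncomputable def sh10 (f : ℕ →₀ ℕ) : ℕ →₀ ℕ :=
  f.comapDomain Nat.succ (Nat.succ_injective.injOn)

/-- inverse of the shift -/
noncomputable def cons10 (c : ℕ) (g : ℕ →₀ ℕ) : ℕ →₀ ℕ :=
  Finsupp.single 0 c + g.embDomain ⟨Nat.succ, Nat.succ_injective⟩

lemma cons10_zero (c : ℕ) (g : ℕ →₀ ℕ) : cons10 c g 0 = c := by
  have : (g.embDomain ⟨Nat.succ, Nat.succ_injective⟩ : ℕ →₀ ℕ) 0 = 0 := by
    apply Finsupp.embDomain_of_notMem_range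
    rintro ⟨x, hx⟩
    exact Nat.succ_ne_zero x hx
  simp [cons10, this]

lemma cons10_succ (c : ℕ) (g : ℕ →₀ ℕ) (i : ℕ) : cons10 c g (i + 1) = g i := by
  have : (g.embDomain ⟨Nat.succ, Nat.succ_injective⟩ : ℕ →₀ ℕ) (i + 1) = g i :=
    Finsupp.embDomain_apply_self ⟨Nat.succ, Nat.succ_injective⟩ g i
  simp [cons10, this]

lemma sh10_apply (f : ℕ →₀ ℕ) (i : ℕ) : sh10 f i = f (i + 1) := rfl

lemma cons10_sh10 (f : ℕ →₀ ℕ) : cons10 (f 0) (sh10 f) = f := by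
  ext i
  cases i with
  | zero => exact cons10_zero _ _
  | succ i => rw [cons10_succ, sh10_apply]

lemma sh10_cons10 (c : ℕ) (g : ℕ →₀ ℕ) : sh10 (cons10 c g) = g := by
  ext i
  rw [sh10_apply, cons10_succ]

lemma wt10_cons10 (m c : ℕ) (g : ℕ →₀ ℕ) : wt10 m (cons10 c g) = c + m * wt10 m g := by
  unfold wt10 cons10
  rw [Finsupp.sum_add_index' (by simp) (by intros; ring), Finsupp.sum_single_index (by simp),
    Finsupp.sum_embDomain, Finsupp.mul_sum]
  simp only [pow_zero, mul_one, Function.Embedding.coeFn_mk, Nat.succ_eq_add_one]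
  congr 1
  apply Finsupp.sum_congr
  intros
  ring

lemma wt10_eq (m : ℕ) (f : ℕ →₀ ℕ) : wt10 m f = f 0 + m * wt10 m (sh10 f) := by
  conv_lhs => rw [← cons10_sh10 f]
  exact wt10_cons10 _ _ _

/-- The recursive decomposition. -/
noncomputable def equiv10 (m : ℕ) (hm : 2 ≤ m) (n : ℕ) :
    {f : ℕ →₀ ℕ // wt10 m f = n} ≃ Σ k : Fin (n / m + 1), {f : ℕ →₀ ℕ // wt10 m f = k} where
  toFun f := ⟨⟨wt10 m (sh10 f.1), by
    have h := wt10_eq m f.1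
    rw [f.2] at h
    rw [Nat.lt_succ_iff, Nat.le_div_iff_mul_le (by omega), mul_comm]
    omega⟩, ⟨sh10 f.1, rfl⟩⟩
  invFun x := ⟨cons10 (n - m * x.1) x.2.1, by
    rw [wt10_cons10, x.2.2]
    have h := x.1.2
    rw [Nat.lt_succ_iff, Nat.le_div_iff_mul_le (by omega), mul_comm] at h
    omega⟩
  left_inv f := by
    apply Subtype.ext
    have h := wt10_eq m f.1
    rw [f.2] at h
    have : n - m * wt10 m (sh10 f.1) = f.1 0 := by omega
    simp only [this, cons10_sh10]
  right_inv x := by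
    obtain ⟨⟨k, hk⟩, ⟨g, hg⟩⟩ := x
    simp only at hg
    subst hg
    have key : ∀ (g₂ : ℕ →₀ ℕ) (_ : g₂ = g) (h1 : wt10 m g₂ < n / m + 1),
        (⟨⟨wt10 m g₂, h1⟩, ⟨g₂, rfl⟩⟩ :
          Σ k : Fin (n / m + 1), {f : ℕ →₀ ℕ // wt10 m f = k}) = ⟨⟨wt10 m g, hk⟩, ⟨g, rfl⟩⟩ := by
      rintro _ rfl _
      rfl
    exact key _ (sh10_cons10 _ _) _

lemma wt10_zero (m : ℕ) (hm : 2 ≤ m) (f : ℕ →₀ ℕ) (h : wt10 m f = 0) : f = 0 := by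
  unfold wt10 Finsupp.sum at h
  rw [Finset.sum_eq_zero_iff] at h
  ext i
  by_contra hi
  have := h i (by simpa using hi)
  have h2 : m ^ i ≠ 0 := pow_ne_zero _ (by omega)
  simp_all

lemma finite10 (m : ℕ) (hm : 2 ≤ m) (n : ℕ) : Finite {f : ℕ →₀ ℕ // wt10 m f = n} := by
  induction n using Nat.strong_induction_on with
  | _ n ih =>
    rcases Nat.eq_zero_or_pos n with rfl | hn
    · have : Subsingleton {f : ℕ →₀ ℕ // wt10 m f = 0} :=
        ⟨fun a b => Subtype.ext ((wt10_zero m hm a.1 a.2).trans (wt10_zero m hm b.1 b.2).symm)⟩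
      infer_instance
    · have (k : Fin (n / m + 1)) : Finite {f : ℕ →₀ ℕ // wt10 m f = k} := by
        apply ih
        have := k.2
        have := Nat.div_lt_self hn (show 1 < m by omega)
        omega
      exact Finite.of_equiv _ (equiv10 m hm n).symm

lemma rec10 (m : ℕ) (hm : 2 ≤ m) (n : ℕ) :
    mAryPartitions m n = ∑ k ∈ Finset.range (n / m + 1), mAryPartitions m k := by
  have hf := finite10 m hm
  have h := Nat.card_congr (equiv10 m hm n)
  rw [Nat.card_sigma] at h
  rw [Finset.sum_range]
  exact h

lemma zero10 (m : ℕ) (hm : 2 ≤ m) : mAryPartitions m 0 = 1 := by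
  have : Unique {f : ℕ →₀ ℕ // wt10 m f = 0} :=
    ⟨⟨⟨0, by simp [wt10]⟩⟩, fun a => Subtype.ext (wt10_zero m hm a.1 a.2)⟩
  exact Nat.card_unique (α := {f : ℕ →₀ ℕ // wt10 m f = 0})

lemma prog10 {R : Type*} [CommRing R] (B : ℕ → R) (s : ℕ) (c : R) (j : ℕ)
    (h : ∀ i < j, B (s + 1 + i) = c) :
    ∑ k ∈ Finset.range (s + j + 1), B k = ∑ k ∈ Finset.range (s + 1), B k + j * c := by
  induction j with
  | zero => simp
  | succ j ih =>
    rw [show s + (j + 1) + 1 = (s + j + 1) + 1 by ring, Finset.sum_range_succ,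
      ih (fun i hi => h i (by omega)), show s + j + 1 = s + 1 + j by ring, h j (by omega)]
    push_cast
    ring

lemma core10 (m : ℕ) (hm : 2 ≤ m) (p : ℕ) [Fact p.Prime] (hp3 : 3 < p)
    (hpm : p ≤ m ^ 2 + m + 1) (B : ℕ → ZMod p) (h0 : B 0 = 1) (A : ℕ → ZMod p)
    (hA : ∀ n, A n = ∑ k ∈ Finset.range (n + 1), B k) (hB : ∀ n, B n = A (n / m))
    (q : ℕ) (hq : A q = 0) (hmax : ∀ k, A k = 0 → k ≤ q) : False := by
  have hA0 : A 0 = 1 := by simp [hA, h0]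
  have hA1 : A 1 = 2 := by
    rw [hA, Finset.sum_range_succ, Finset.sum_range_one, hB 1,
      Nat.div_eq_of_lt (by omega), hA0, h0]
    norm_num
  have hq2 : 2 ≤ q := by
    by_contra hlt
    have : q = 0 ∨ q = 1 := by omega
    rcases this with rfl | rfl
    · rw [hA0] at hq; exact one_ne_zero hq
    · rw [hA1] at hq
      have h2 : ((2 : ℕ) : ZMod p) = 0 := by exact_mod_cast hq
      rw [ZMod.natCast_eq_zero_iff] at h2
      have := Nat.le_of_dvd (by norm_num) h2
      omega
  have hblock : ∀ k r, r < m → B (m * k + r) = A k := by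
    intro k r hr
    rw [hB, Nat.mul_add_div (by omega), Nat.div_eq_of_lt hr, add_zero]
  have hmq : 2 * q ≤ m * q := Nat.mul_le_mul_right q hm
  obtain ⟨s, hs⟩ : ∃ s, m * q = s + 1 := ⟨m * q - 1, by omega⟩
  have hAs : ∀ j ≤ m, A (s + j) = A s := by
    intro j hj
    rw [hA, hA, prog10 B s 0 j]
    · simp
    · intro i hi
      rw [← hs, hblock q i (by omega), hq]
  have hc : A s ≠ 0 := fun h => by
    have := hmax s h
    omega
  have hms : 2 * s ≤ m * s := Nat.mul_le_mul_right s hm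
  obtain ⟨t, ht⟩ : ∃ t, m * s = t + 1 := ⟨m * s - 1, by omega⟩
  have hAt : ∀ j ≤ m ^ 2 + m, A (t + j) = A t + j * A s := by
    intro j hj
    rw [hA (t + j), hA t, prog10 B t (A s) j]
    intro i hi
    rw [← ht, hB, Nat.mul_add_div (by omega)]
    apply hAs
    have : i / m < m + 1 := by
      rw [Nat.div_lt_iff_lt_mul (by omega)]
      nlinarith
    omega
  set x : ZMod p := -A t / A s with hx
  have hxl := ZMod.val_lt x
  have := hAt x.val (by omega)
  rw [ZMod.natCast_zmod_val, hx, div_mul_cancel₀ _ hc, add_neg_cancel] at this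
  have := hmax _ this
  omega

/-- Corollary 3 (colb), part 1, of the paper. -/
theorem stmt_10 (m : ℕ) (hm : 2 ≤ m) (p : ℕ) (hp : p.Prime) (hp3 : 3 < p)
    (hpm : p ≤ m ^ 2 + m + 1)
    (hex : ∃ n₁ : ℕ, p ∣ mAryPartitions m n₁) :
    {n : ℕ | p ∣ mAryPartitions m n}.Infinite := by
  intro hfin
  have : Fact p.Prime := ⟨hp⟩
  obtain ⟨n, hn, hmax⟩ := hfin.exists_maximalFor id _ hex
  have hB : ∀ n, (mAryPartitions m n : ZMod p) =
      ∑ k ∈ Finset.range (n / m + 1), (mAryPartitions m k : ZMod p) := by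
    intro n
    rw [rec10 m hm n]
    push_cast
    rfl
  refine core10 m hm p hp3 hpm (fun n => (mAryPartitions m n : ZMod p))
    (by simp [zero10 m hm]) _ (fun _ => rfl) hB (n / m) ?_ ?_
  · rw [← hB, ZMod.natCast_eq_zero_iff]
    exact hn
  · intro k hk
    have h2 : p ∣ mAryPartitions m (m * k) := by
      rw [← ZMod.natCast_eq_zero_iff, hB, Nat.mul_div_cancel_left _ (by omega)]
      exact hk
    have h3 : m * k ≤ n := by
      by_contra hlt
      have := hmax (j := m * k) h2 (by simp only [id]; omega)
      simp only [id] at this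
      omega
    rw [Nat.le_div_iff_mul_le (by omega), mul_comm]
    exact h3
end

section
/- Let m ≥ 2 and let p be a prime with 3 < p ≤ m² + m + 1. If there exists n₁ such that c_m(n₁) ≡ 0 (mod p), then the congruence c_m(n) ≡ 0 (mod p) has infinitely many solutions n ∈ ℕ. -/
namespace NoGaps

/-- weight of a partition -/
def W (m : ℕ) (f : ℕ →₀ ℕ) : ℕ := f.sum fun i c => c * m ^ i

/-- the no-gap property -/
def NG (f : ℕ →₀ ℕ) : Prop := ∀ j : ℕ, 1 ≤ j → 0 < f j → 0 < f (j - 1)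

/-- partitions of `n` -/
abbrev T (m n : ℕ) := {f : ℕ →₀ ℕ // W m f = n ∧ NG f}

/-- prepend a value -/
noncomputable def cons (c : ℕ) (g : ℕ →₀ ℕ) : ℕ →₀ ℕ :=
  Finsupp.single 0 c + g.mapDomain Nat.succ

lemma cons_zero (c : ℕ) (g : ℕ →₀ ℕ) : cons c g 0 = c := by
  have : g.mapDomain Nat.succ 0 = 0 := Finsupp.mapDomain_notin_range _ _ (by simp)
  simp [cons, this]

lemma cons_succ (c : ℕ) (g : ℕ →₀ ℕ) (i : ℕ) : cons c g (i + 1) = g i := by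
  have : g.mapDomain Nat.succ (i + 1) = g i :=
    Finsupp.mapDomain_apply Nat.succ_injective g i
  simp [cons, this]

lemma W_cons (m c : ℕ) (g : ℕ →₀ ℕ) : W m (cons c g) = c + m * W m g := by
  unfold W cons
  rw [Finsupp.sum_add_index' (by simp) (by intros; ring), Finsupp.sum_single_index (by simp),
    Finsupp.sum_mapDomain_index (by simp) (by intros; ring), Finsupp.mul_sum]
  simp only [pow_zero, mul_one]
  congr 1
  refine Finsupp.sum_congr fun i _ => ?_
  rw [pow_succ]; ring

lemma exists_cons (f : ℕ →₀ ℕ) : ∃ g, f = cons (f 0) g := by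
  refine ⟨f.comapDomain Nat.succ Nat.succ_injective.injOn, ?_⟩
  ext i
  cases i with
  | zero => rw [cons_zero]
  | succ i => rw [cons_succ]; simp [Finsupp.comapDomain_apply]

lemma NG_cons {c : ℕ} (hc : 0 < c) {g : ℕ →₀ ℕ} (hg : NG g) : NG (cons c g) := by
  intro j hj h
  obtain ⟨i, rfl⟩ : ∃ i, j = i + 1 := ⟨j - 1, by omega⟩
  simp only [Nat.add_sub_cancel]
  cases i with
  | zero => rwa [cons_zero]
  | succ i =>
    rw [cons_succ] at h ⊢
    exact hg (i + 1) (by omega) h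

lemma NG_of_cons {c : ℕ} {g : ℕ →₀ ℕ} (hg : NG (cons c g)) : NG g := by
  intro j hj h
  obtain ⟨i, rfl⟩ : ∃ i, j = i + 1 := ⟨j - 1, by omega⟩
  have := hg (i + 2) (by omega) (by rwa [cons_succ])
  simpa [cons_succ] using this

lemma eq_zero_of_NG {f : ℕ →₀ ℕ} (hf : NG f) (h0 : f 0 = 0) : f = 0 := by
  ext i
  induction i with
  | zero => simpa using h0
  | succ i ih =>
    by_contra h
    have := hf (i + 1) (by omega) (Nat.pos_of_ne_zero (by simpa using h))
    simp at this ih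
    omega

/-- the decomposition map -/
noncomputable def glue (m n : ℕ) : (Σ k : Fin (n / m + 1), T m k) → T m (n + 1) := fun x =>
  ⟨cons (n + 1 - m * x.1) x.2.1, by
    have h : m * (x.1 : ℕ) ≤ n :=
      (Nat.mul_le_mul_left m (Nat.lt_succ_iff.1 x.1.2)).trans (Nat.mul_div_le n m)
    refine ⟨?_, NG_cons (by omega) x.2.2.2⟩
    rw [W_cons, x.2.2.1]; omega⟩

lemma glue_bij (m n : ℕ) (hm : 0 < m) : Function.Bijective (glue m n) := by
  constructor
  · rintro ⟨⟨k, hk⟩, ⟨g, hg, hg'⟩⟩ ⟨⟨l, hl⟩, ⟨h, hh, hh'⟩⟩ e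
    have e' := congrArg Subtype.val e
    simp only [glue] at e'
    have : g = h := by
      ext i
      have := DFunLike.congr_fun e' (i + 1)
      rwa [cons_succ, cons_succ] at this
    subst this
    simp only at hg hh
    subst hg
    subst hh
    rfl
  · rintro ⟨f, hf, hng⟩
    have h0 : 0 < f 0 := by
      by_contra h
      have := eq_zero_of_NG hng (by omega)
      subst this
      simp [W] at hf
    obtain ⟨g, hg⟩ := exists_cons f
    have hw := W_cons m (f 0) g
    rw [← hg, hf] at hw
    have hk : W m g < n / m + 1 := by
      rw [Nat.lt_succ_iff, Nat.le_div_iff_mul_le hm, mul_comm]; omega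
    have hgn : NG g := by rw [hg] at hng; exact NG_of_cons hng
    refine ⟨⟨⟨W m g, hk⟩, ⟨g, rfl, hgn⟩⟩, ?_⟩
    apply Subtype.ext
    simp only [glue]
    conv_rhs => rw [hg]
    congr 1
    omega

lemma W_eq_zero {m : ℕ} (hm : 0 < m) {f : ℕ →₀ ℕ} (h : W m f = 0) : f = 0 := by
  by_contra hne
  obtain ⟨i, hi⟩ := Finsupp.support_nonempty_iff.2 hne
  unfold W Finsupp.sum at h
  rw [Finset.sum_eq_zero_iff] at h
  have := h i hi
  simp at this hi
  omega

lemma finT (m : ℕ) (hm : 0 < m) (n : ℕ) : Finite (T m n) := by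
  induction n using Nat.strong_induction_on with
  | _ n ih =>
    cases n with
    | zero =>
      have : Subsingleton (T m 0) :=
        ⟨fun a b => Subtype.ext ((W_eq_zero hm a.2.1).trans (W_eq_zero hm b.2.1).symm)⟩
      infer_instance
    | succ n =>
      have : ∀ k : Fin (n / m + 1), Finite (T m k) := fun k => ih k (by
        have := k.2
        have := Nat.div_le_self n m
        omega)
      exact Finite.of_surjective _ (glue_bij m n hm).2

lemma c_eq (m n : ℕ) : mAryPartitionsNoGaps m n = Nat.card (T m n) := rfl

lemma c_zero (m : ℕ) (hm : 0 < m) : mAryPartitionsNoGaps m 0 = 1 := by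
  rw [c_eq, Nat.card_eq_one_iff_unique]
  exact ⟨⟨fun a b => Subtype.ext ((W_eq_zero hm a.2.1).trans (W_eq_zero hm b.2.1).symm)⟩,
    ⟨⟨0, by simp [W], by intro j _ h; simp at h⟩⟩⟩

/-- partial sums -/
noncomputable def S (m j : ℕ) : ℕ := ∑ k ∈ Finset.range (j + 1), mAryPartitionsNoGaps m k

lemma c_succ (m n : ℕ) (hm : 0 < m) : mAryPartitionsNoGaps m (n + 1) = S m (n / m) := by
  have := fun k : Fin (n / m + 1) => finT m hm k
  rw [c_eq, ← Nat.card_eq_of_bijective _ (glue_bij m n hm), Nat.card_sigma, S,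
    Finset.sum_range]
  rfl

lemma S_succ (m n : ℕ) (hm : 0 < m) : S m (n + 1) = S m n + S m (n / m) := by
  rw [← c_succ m n hm, S, Finset.sum_range_succ]; rfl

lemma S_zero (m : ℕ) (hm : 0 < m) : S m 0 = 1 := by
  simp [S, c_zero m hm]

lemma step (m : ℕ) (hm : 2 ≤ m) (p : ℕ) (hp : p.Prime) (hpm : p ≤ m ^ 2 + m + 1)
    (j : ℕ) (hj : p ∣ S m j) : ∃ i, j < i ∧ p ∣ S m i := by
  haveI : Fact p.Prime := ⟨hp⟩
  have hm0 : 0 < m := by omega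
  have hj0 : 0 < j := by
    rcases Nat.eq_zero_or_pos j with rfl | h
    · rw [S_zero m hm0] at hj
      exact absurd (Nat.dvd_one.1 hj) hp.one_lt.ne'
    · exact h
  have hjm : j < m * j := by nlinarith
  simp only [← ZMod.natCast_eq_zero_iff] at hj ⊢
  have h1 : ∀ t, t ≤ m → (S m (m * j + t) : ZMod p) = S m (m * j) := by
    intro t
    induction t with
    | zero => simp
    | succ t ih =>
      intro ht
      have hd : (m * j + t) / m = j := by
        rw [Nat.mul_add_div hm0, Nat.div_eq_of_lt (by omega), add_zero]
      rw [← add_assoc, S_succ _ _ hm0, hd]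
      push_cast
      rw [hj, ih (by omega), add_zero]
  have h2 : ∀ t, t ≤ m ^ 2 + m →
      (S m (m * (m * j) + t) : ZMod p) = S m (m * (m * j)) + t * S m (m * j) := by
    intro t
    induction t with
    | zero => simp
    | succ t ih =>
      intro ht
      have hd : (m * (m * j) + t) / m = m * j + t / m := Nat.mul_add_div hm0 _ _
      have ht' : t / m ≤ m := by
        rw [← Nat.lt_succ_iff, Nat.div_lt_iff_lt_mul hm0]
        have : (m + 1) * m = m ^ 2 + m := by ring
        simp only [Nat.succ_eq_add_one]
        omega
      rw [← add_assoc, S_succ _ _ hm0, hd]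
      push_cast
      rw [h1 _ ht', ih (by omega)]
      ring
  by_cases ha : (S m (m * j) : ZMod p) = 0
  · exact ⟨m * j, hjm, ha⟩
  · set b : ZMod p := -(S m (m * (m * j))) / S m (m * j) with hb
    refine ⟨m * (m * j) + b.val, by nlinarith, ?_⟩
    have := ZMod.val_lt b
    rw [h2 _ (by omega), ZMod.natCast_zmod_val, hb, div_mul_cancel₀ _ ha]
    ring

end NoGaps

open NoGaps in
/-- Corollary 3 (colb), part 2, of the paper. -/
theorem stmt_11 (m : ℕ) (hm : 2 ≤ m) (p : ℕ) (hp : p.Prime) (hp3 : 3 < p)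
    (hpm : p ≤ m ^ 2 + m + 1)
    (hex : ∃ n₁ : ℕ, p ∣ mAryPartitionsNoGaps m n₁) :
    {n : ℕ | p ∣ mAryPartitionsNoGaps m n}.Infinite := by
  have hm0 : 0 < m := by omega
  have key : ∀ N, ∃ i, N ≤ i ∧ p ∣ S m i := by
    intro N
    induction N with
    | zero =>
      obtain ⟨n, hn⟩ := hex
      cases n with
      | zero =>
        rw [c_zero m hm0] at hn
        exact absurd (Nat.dvd_one.1 hn) hp.one_lt.ne'
      | succ n => exact ⟨n / m, Nat.zero_le _, by rwa [c_succ m n hm0] at hn⟩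
    | succ N ih =>
      obtain ⟨i, hi, h⟩ := ih
      obtain ⟨k, hk, h'⟩ := step m hm p hp hpm i h
      exact ⟨k, by omega, h'⟩
  refine Set.infinite_of_forall_exists_gt fun N => ?_
  obtain ⟨i, hi, h⟩ := key N
  refine ⟨m * i + 1, ?_, by nlinarith⟩
  rw [Set.mem_setOf_eq, c_succ _ _ hm0, Nat.mul_div_cancel_left _ hm0]
  exact h
end

section
/- Let m ≥ 2. Then for every n ≥ 1 and every q ∈ {0,…,m−1}: (1) c_m(m(mn+q+1)+1) ≡ 1 + (q+1)·c_m(mn+1) (mod m), and (2) ovb_m(m(mn+q)) ≡ (2q+1)·ovb_m(mn) (mod m). -/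
/-- The set of no-gap `m`-ary partitions. -/
def NGP (m n : ℕ) : Type :=
  {f : ℕ →₀ ℕ // (f.sum fun i c => c * m ^ i) = n ∧
    ∀ j : ℕ, 1 ≤ j → 0 < f j → 0 < f (j - 1)}

noncomputable def ngpCons (a : ℕ) (g : ℕ →₀ ℕ) : ℕ →₀ ℕ :=
  Finsupp.single 0 a + g.mapDomain Nat.succ

lemma ngpCons_zero (a : ℕ) (g : ℕ →₀ ℕ) : ngpCons a g 0 = a := by
  have : (g.mapDomain Nat.succ) 0 = 0 := Finsupp.mapDomain_of_notMem_range _ _ (by simp)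
  simp [ngpCons, this]

lemma ngpCons_succ (a : ℕ) (g : ℕ →₀ ℕ) (k : ℕ) : ngpCons a g (k + 1) = g k := by
  have : (g.mapDomain Nat.succ) (k + 1) = g k :=
    Finsupp.mapDomain_apply Nat.succ_injective _ _
  simp [ngpCons, this]

lemma ngpCons_weight (m a : ℕ) (g : ℕ →₀ ℕ) :
    ((ngpCons a g).sum fun i c => c * m ^ i) = a + m * (g.sum fun i c => c * m ^ i) := by
  unfold ngpCons
  rw [Finsupp.sum_add_index' (by simp) (by intros; ring),
    Finsupp.sum_mapDomain_index (by simp) (by intros; ring), Finsupp.sum_single_index (by simp)]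
  simp only [Finsupp.sum, Finset.mul_sum, pow_zero, mul_one]
  congr 1
  refine Finset.sum_congr rfl fun x _ => ?_
  rw [Nat.succ_eq_add_one]; ring

lemma exists_ngpCons (f : ℕ →₀ ℕ) : ∃ a g, f = ngpCons a g := by
  refine ⟨f 0, f.comapDomain Nat.succ Nat.succ_injective.injOn, ?_⟩
  ext k
  cases k with
  | zero => rw [ngpCons_zero]
  | succ k => rw [ngpCons_succ]; rfl

noncomputable def ngpMap (m N j : ℕ) (hj : 1 ≤ j) :
    (Σ i : Fin (N + 1), NGP m i) → NGP m (m * N + j) := fun x =>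
  ⟨ngpCons (m * N + j - m * x.1) x.2.1, by
    obtain ⟨⟨i, hi⟩, g, hg, hgap⟩ := x
    have h1 : m * i ≤ m * N := Nat.mul_le_mul_left _ (by omega)
    simp only at hg ⊢
    refine ⟨by rw [ngpCons_weight, hg]; omega, ?_⟩
    intro k hk hpos
    obtain ⟨k, rfl⟩ : ∃ l, k = l + 1 := ⟨k - 1, by omega⟩
    rw [ngpCons_succ] at hpos
    rw [Nat.add_sub_cancel]
    cases k with
    | zero => rw [ngpCons_zero]; omega
    | succ l =>
      rw [ngpCons_succ]
      exact hgap (l + 1) (by omega) hpos⟩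

lemma ngpMap_bij (m N j : ℕ) (hm : 2 ≤ m) (hj : 1 ≤ j) (hjm : j ≤ m) :
    Function.Bijective (ngpMap m N j hj) := by
  constructor
  · rintro ⟨⟨i, hi⟩, g, hg, hgap⟩ ⟨⟨i', hi'⟩, g', hg', hgap'⟩ h
    have h := congrArg Subtype.val h
    have hgg : g = g' := by
      ext k
      have := DFunLike.congr_fun h (k + 1)
      simpa only [ngpMap, ngpCons_succ] using this
    subst hgg
    simp only at hg hg'
    subst hg
    subst hg'
    rfl
  · rintro ⟨f, hf, hgap⟩
    obtain ⟨a, g, rfl⟩ := exists_ngpCons f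
    rw [ngpCons_weight] at hf
    have hgg : ∀ k : ℕ, 1 ≤ k → 0 < g k → 0 < g (k - 1) := by
      intro k hk hp
      have := hgap (k + 1) (by omega) (by rwa [ngpCons_succ])
      obtain ⟨l, rfl⟩ : ∃ l, k = l + 1 := ⟨k - 1, by omega⟩
      simpa [ngpCons_succ] using this
    have ha : 0 < a := by
      by_contra h0
      have hz : ∀ k, ngpCons a g k = 0 := by
        intro k
        induction k with
        | zero => rw [ngpCons_zero]; omega
        | succ k ih =>
          by_contra hne
          have := hgap (k + 1) (by omega) (by omega)
          simp only [Nat.add_sub_cancel] at this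
          omega
      have hg0 : g = 0 := by
        ext k
        have := hz (k + 1)
        rwa [ngpCons_succ] at this
      rw [hg0] at hf
      simp at hf
      omega
    have hlt : (g.sum fun i c => c * m ^ i) < N + 1 := by
      by_contra hge
      have : m * (N + 1) ≤ m * (g.sum fun i c => c * m ^ i) :=
        Nat.mul_le_mul_left _ (by omega)
      rw [mul_add] at this
      omega
    refine ⟨⟨⟨_, hlt⟩, g, rfl, hgg⟩, ?_⟩
    apply Subtype.ext
    simp only [ngpMap]
    congr 1
    omega

lemma ngp_zero_eq (m : ℕ) (hm : 2 ≤ m) (f : NGP m 0) : f.1 = 0 := by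
  obtain ⟨f, hf, -⟩ := f
  ext k
  by_contra hne
  rw [Finsupp.sum, Finset.sum_eq_zero_iff] at hf
  have := hf k (by simpa using hne)
  simp at this
  rcases this with h | h
  · exact hne h
  · omega

lemma exists_decomp (m n : ℕ) (hm : 2 ≤ m) (hn : 1 ≤ n) :
    ∃ N j, 1 ≤ j ∧ j ≤ m ∧ n = m * N + j := by
  refine ⟨(n - 1) / m, (n - 1) % m + 1, by omega, Nat.mod_lt _ (by omega), ?_⟩
  have := Nat.div_add_mod (n - 1) m
  omega

lemma ngp_finite (m : ℕ) (hm : 2 ≤ m) (n : ℕ) : Finite (NGP m n) := by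
  induction n using Nat.strong_induction_on with
  | _ n ih =>
    rcases Nat.eq_zero_or_pos n with rfl | hn
    · have : Subsingleton (NGP m 0) :=
        ⟨fun a b => Subtype.ext ((ngp_zero_eq m hm a).trans (ngp_zero_eq m hm b).symm)⟩
      infer_instance
    · obtain ⟨N, j, hj, hjm, rfl⟩ := exists_decomp m n hm hn
      have : ∀ i : Fin (N + 1), Finite (NGP m i) := fun i => ih i (by nlinarith [i.2])
      exact Finite.of_surjective _ (ngpMap_bij m N j hm hj hjm).2

lemma c_zero (m : ℕ) (hm : 2 ≤ m) : mAryPartitionsNoGaps m 0 = 1 := by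
  change Nat.card (NGP m 0) = 1
  rw [Nat.card_eq_one_iff_unique]
  exact ⟨⟨fun a b => Subtype.ext ((ngp_zero_eq m hm a).trans (ngp_zero_eq m hm b).symm)⟩,
    ⟨⟨0, by simp⟩⟩⟩

lemma c_rec (m N j : ℕ) (hm : 2 ≤ m) (hj : 1 ≤ j) (hjm : j ≤ m) :
    mAryPartitionsNoGaps m (m * N + j) =
      ∑ i ∈ Finset.range (N + 1), mAryPartitionsNoGaps m i := by
  change Nat.card (NGP m (m * N + j)) = _
  have : ∀ i : Fin (N + 1), Finite (NGP m i) := fun i => ngp_finite m hm i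
  rw [← Nat.card_congr (Equiv.ofBijective _ (ngpMap_bij m N j hm hj hjm)), Nat.card_sigma,
    Finset.sum_range]
  rfl

/-- Sums of block-constant sequences modulo the block length. -/
lemma block_sum (m : ℕ) (F G : ℕ → ℤ) (h : ∀ n j, j < m → F (m * n + j) = G n) (n q : ℕ)
    (hq : q ≤ m) : (m : ℤ) ∣ (∑ i ∈ Finset.range (m * n + q), F i) - q * G n := by
  have key : ∀ n q, q ≤ m → ∑ i ∈ Finset.range (m * n + q), F i =
      ∑ i ∈ Finset.range (m * n), F i + q * G n := by
    intro n q hq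
    rw [Finset.sum_range_add, Finset.sum_congr rfl
      (fun j hj => h n j (by have := Finset.mem_range.1 hj; omega))]
    simp
  have h0 : ∀ n, (m : ℤ) ∣ ∑ i ∈ Finset.range (m * n), F i := by
    intro n
    induction n with
    | zero => simp
    | succ n ih =>
      rw [Nat.mul_succ, key n m le_rfl]
      exact dvd_add ih (dvd_mul_right _ _)
  rw [key n q hq]
  simpa using h0 n

theorem stmt_16 (m : ℕ) (hm : 2 ≤ m)
    (ov : ℕ → ℤ) (hov0 : ov 0 = 1)
    (hovflat : ∀ n : ℕ, ∀ j : ℕ, j < m → ov (m * n + j) = ov (m * n))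
    (hovrec : ∀ n : ℕ, 1 ≤ n → ov (m * n) - ov (m * n - 1) = ov n + ov (n - 1)) :
    ∀ n : ℕ, 1 ≤ n → ∀ q : ℕ, q < m →
      (mAryPartitionsNoGaps m (m * (m * n + q + 1) + 1) ≡
        1 + (q + 1) * mAryPartitionsNoGaps m (m * n + 1) [MOD m]) ∧
      (ov (m * (m * n + q)) ≡ (2 * (q : ℤ) + 1) * ov (m * n) [ZMOD (m : ℤ)]) := by
  intro n hn q hq
  constructor
  · rw [c_rec m (m * n + q + 1) 1 hm le_rfl (by omega), Finset.sum_range_succ', c_zero m hm,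
      ← Int.natCast_modEq_iff]
    have := block_sum m (fun i => (mAryPartitionsNoGaps m (i + 1) : ℤ))
      (fun n => (mAryPartitionsNoGaps m (m * n + 1) : ℤ)) (by
        intro n j hj
        rw [add_assoc, c_rec m n (j + 1) hm (by omega) (by omega),
          c_rec m n 1 hm (by omega) (by omega)]) n (q + 1) hq
    apply Int.ModEq.symm
    rw [Int.modEq_iff_dvd]
    convert this using 1
    push_cast
    rw [add_assoc (m * n)]
    ring
  · have hsum : ∀ N, ov (m * N) = 2 * ∑ k ∈ Finset.range N, ov k + ov N := by
      intro N
      induction N with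
      | zero => simp
      | succ N ih =>
        have h1 := hovrec (N + 1) (by omega)
        have h2 : m * (N + 1) - 1 = m * N + (m - 1) := by rw [mul_add]; omega
        rw [h2, hovflat N (m - 1) (by omega), ih, Nat.add_sub_cancel] at h1
        rw [Finset.sum_range_succ]
        linarith
    rw [hsum, hovflat n q hq]
    have := block_sum m ov (fun n => ov (m * n)) hovflat n q hq.le
    apply Int.ModEq.symm
    rw [Int.modEq_iff_dvd]
    have h2 := this.mul_left 2
    beta_reduce at h2
    have e : ∀ a b : ℤ, 2 * a + b - (2 * (q : ℤ) + 1) * b = 2 * (a - q * b) := by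
      intro a b; ring
    rw [e]
    exact h2
end

section
/- Let m ≥ 2 and n ∈ ℕ₀, and write n in base m as n = a_0 + a_1·m + ⋯ + a_s·m^s with digits 0 ≤ a_j ≤ m−1. Then ovb_m(mn) ≡ ∏_{j=0}^s (2a_j + 1) (mod m). -/
/-- Corollary 7 (charactovbcol) of the paper. `ov` is the sequence `ovb_m`. -/
theorem stmt_17 (m : ℕ) (hm : 2 ≤ m)
    (ov : ℕ → ℤ) (hov0 : ov 0 = 1)
    (hovflat : ∀ n : ℕ, ∀ j : ℕ, j < m → ov (m * n + j) = ov (m * n))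
    (hovrec : ∀ n : ℕ, 1 ≤ n → ov (m * n) - ov (m * n - 1) = ov n + ov (n - 1))
    (n s : ℕ) (a : ℕ → ℕ)
    (ha : ∀ j : ℕ, j ≤ s → a j ≤ m - 1)
    (hn : n = ∑ j ∈ Finset.range (s + 1), a j * m ^ j) :
    ov (m * n) ≡ ∏ j ∈ Finset.range (s + 1), (2 * (a j : ℤ) + 1) [ZMOD (m : ℤ)] := by
  have step : ∀ k : ℕ, ov (m * (k + 1)) = ov (m * k) + ov (k + 1) + ov k := by
    intro k
    have h := hovrec (k + 1) (by omega)
    have h2 : m * (k + 1) - 1 = m * k + (m - 1) := by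
      rw [Nat.mul_succ]; omega
    rw [h2, hovflat k (m - 1) (by omega), Nat.add_sub_cancel] at h
    linarith
  have lin : ∀ q r : ℕ, r < m →
      ov (m * (m * q + r)) = ov (m * (m * q)) + 2 * r * ov (m * q) := by
    intro q r
    induction r with
    | zero => intro _; simp
    | succ r ih =>
      intro hr
      have h := step (m * q + r)
      rw [ih (by omega), hovflat q r (by omega), add_assoc, hovflat q (r + 1) hr] at h
      rw [h]; push_cast; ring
  have base : ∀ q : ℕ, ov (m * (m * q)) ≡ ov (m * q) [ZMOD (m : ℤ)] := by
    intro q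
    induction q with
    | zero => simp
    | succ q ih =>
      have h := step (m * q + (m - 1))
      have e : m * q + (m - 1) + 1 = m * (q + 1) := by
        rw [Nat.mul_succ]; omega
      rw [e, lin q (m - 1) (by omega), hovflat q (m - 1) (by omega)] at h
      obtain ⟨c, hc⟩ := ih.dvd
      apply Int.modEq_iff_dvd.2
      refine ⟨c - 2 * ov (m * q), ?_⟩
      rw [h, Nat.cast_sub (by omega)]
      push_cast
      linear_combination hc
  have main : ∀ (t : ℕ) (a : ℕ → ℕ), (∀ j < t, a j < m) →
      ov (m * ∑ j ∈ Finset.range t, a j * m ^ j) ≡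
        ∏ j ∈ Finset.range t, (2 * (a j : ℤ) + 1) [ZMOD (m : ℤ)] := by
    intro t
    induction t with
    | zero => intro a _; simp [hov0]
    | succ t ih =>
      intro a ha
      have h := ih (fun j => a (j + 1)) (fun j hj => ha (j + 1) (by omega))
      rw [Finset.sum_range_succ', Finset.prod_range_succ']
      have e : ∑ j ∈ Finset.range t, a (j + 1) * m ^ (j + 1)
          = m * ∑ j ∈ Finset.range t, a (j + 1) * m ^ j := by
        rw [Finset.mul_sum]
        exact Finset.sum_congr rfl fun j _ => by ring
      rw [e, pow_zero, mul_one, lin _ _ (ha 0 (by omega))]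
      refine ((base _).add_right _).trans ?_
      have h2 := h.mul_right (2 * (a 0 : ℤ) + 1)
      convert h2 using 1
      ring
  rw [hn]
  exact main (s + 1) a fun j hj => by have := ha j (by omega); omega
end

section
/- Let m ≥ 2 and let n = a_0 + a_1·m + ⋯ + a_s·m^s where 1 ≤ a_j ≤ m−1 for every j = 0,…,s (that is, n has no zero digits in its base-m representation). Then ovb_m(mn) ≡ ∏_{i=0}^s (2a_i + 1) + 2m·∑_{i=1}^s [ a_i² · ∏_{0 ≤ j ≤ s, j ≠ i, j ≠ i−1} (2a_j + 1) ] (mod m²). -/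
open Finset in
lemma aux_T (m : ℕ) (ov : ℕ → ℤ)
    (hovflat : ∀ n : ℕ, ∀ j : ℕ, j < m → ov (m * n + j) = ov (m * n)) (q : ℕ) :
    ∀ r, r ≤ m → ∑ k ∈ range (m * q + r), ov k
      = m * ∑ k ∈ range q, ov (m * k) + r * ov (m * q) := by
  have step : ∀ q, (∑ k ∈ range (m * q), ov k = m * ∑ k ∈ range q, ov (m * k)) →
      ∀ r, r ≤ m → ∑ k ∈ range (m * q + r), ov k
      = m * ∑ k ∈ range q, ov (m * k) + r * ov (m * q) := by
    intro q hq r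
    induction r with
    | zero => intro _; simp [hq]
    | succ r ih =>
      intro hr
      rw [← add_assoc, sum_range_succ, ih (by omega), hovflat q r (by omega)]
      push_cast; ring
  apply step
  induction q with
  | zero => simp
  | succ q ih =>
    rw [mul_add, mul_one, step q ih m le_rfl, sum_range_succ]; ring

open Finset in
lemma aux_c (m : ℕ) (hm : 2 ≤ m) (ov : ℕ → ℤ) (hov0 : ov 0 = 1)
    (hovflat : ∀ n : ℕ, ∀ j : ℕ, j < m → ov (m * n + j) = ov (m * n))
    (hovrec : ∀ n : ℕ, 1 ≤ n → ov (m * n) - ov (m * n - 1) = ov n + ov (n - 1)) (q r : ℕ)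
    (hr : r < m) :
    ov (m * (m * q + r)) = (2 * r + 1) * ov (m * q) + 2 * m * ∑ k ∈ range q, ov (m * k) := by
  have h : ∀ n, ov (m * n) = 2 * ∑ k ∈ range n, ov k + ov n := by
    intro n
    induction n with
    | zero => simp
    | succ n ih =>
      have h1 := hovrec (n + 1) (by omega)
      have h2 : m * (n + 1) - 1 = m * n + (m - 1) := by rw [mul_add]; omega
      rw [h2, hovflat n (m - 1) (by omega), ih] at h1
      rw [sum_range_succ]
      simp only [Nat.add_sub_cancel] at h1
      linarith
  rw [h, aux_T m ov hovflat q r hr.le, hovflat q r hr]; ring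

open Finset in
lemma aux_S (m : ℕ) (c : ℕ → ℤ)
    (hc : ∀ q r, r < m → c (m * q + r) = (2 * r + 1) * c q + 2 * m * ∑ k ∈ range q, c k)
    (q : ℕ) : ∀ r, r ≤ m → ∑ k ∈ range (m * q + r), c k ≡ r ^ 2 * c q [ZMOD m] := by
  have step : ∀ q, (∑ k ∈ range (m * q), c k ≡ 0 [ZMOD m]) →
      ∀ r, r ≤ m → ∑ k ∈ range (m * q + r), c k ≡ r ^ 2 * c q [ZMOD m] := by
    intro q hq r
    induction r with
    | zero => intro _; simpa using hq
    | succ r ih =>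
      intro hr
      rw [← add_assoc, sum_range_succ, hc q r (by omega)]
      have := ih (by omega)
      rw [Int.modEq_iff_dvd] at this ⊢
      obtain ⟨t, ht⟩ := this
      refine ⟨t - 2 * ∑ k ∈ range q, c k, ?_⟩
      push_cast
      linear_combination ht
  apply step
  induction q with
  | zero => simp
  | succ q ih =>
    rw [mul_add, mul_one]
    refine (step q ih m le_rfl).trans ?_
    rw [Int.modEq_zero_iff_dvd]
    exact ⟨m * c q, by ring⟩

open Finset in
lemma aux_shift (m k : ℕ) (a : ℕ → ℕ) :
    ∑ j ∈ range (k + 1), a j * m ^ j = m * (∑ j ∈ range k, a (j + 1) * m ^ j) + a 0 := by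
  rw [sum_range_succ', mul_sum]
  simp only [pow_zero, mul_one, Nat.add_right_cancel_iff]
  exact sum_congr rfl fun j _ => by ring

open Finset in
lemma aux_mod (m : ℕ) (c : ℕ → ℤ) (hc0 : c 0 = 1)
    (hc : ∀ q r, r < m → c (m * q + r) = (2 * r + 1) * c q + 2 * m * ∑ k ∈ range q, c k)
    (k : ℕ) : ∀ a : ℕ → ℕ, (∀ j, j < k → a j < m) →
      c (∑ j ∈ range k, a j * m ^ j) ≡ ∏ j ∈ range k, (2 * (a j : ℤ) + 1) [ZMOD m] := by
  induction k with
  | zero => intro a _; simp [hc0]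
  | succ k ih =>
    intro a ha
    rw [aux_shift, hc _ _ (ha 0 (by omega)), prod_range_succ']
    have := ih (fun j => a (j + 1)) (fun j hj => ha (j + 1) (by omega))
    rw [Int.modEq_iff_dvd] at this ⊢
    obtain ⟨t, ht⟩ := this
    refine ⟨(2 * a 0 + 1) * t
      - 2 * ∑ k ∈ range (∑ j ∈ range k, a (j + 1) * m ^ j), c k, ?_⟩
    linear_combination (2 * (a 0 : ℤ) + 1) * ht

open Finset in
lemma aux_main (m : ℕ) (c : ℕ → ℤ) (hc0 : c 0 = 1)
    (hc : ∀ q r, r < m → c (m * q + r) = (2 * r + 1) * c q + 2 * m * ∑ k ∈ range q, c k)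
    (s : ℕ) : ∀ a : ℕ → ℕ, (∀ j, j < s + 1 → a j < m) →
      c (∑ j ∈ range (s + 1), a j * m ^ j) ≡ ∏ j ∈ range (s + 1), (2 * (a j : ℤ) + 1) +
        2 * (m : ℤ) * ∑ i ∈ range s, (a (i + 1) : ℤ) ^ 2 *
          ∏ j ∈ range (s + 1), (if j ≠ i + 1 ∧ j ≠ i then (2 * (a j : ℤ) + 1) else 1)
        [ZMOD (m : ℤ) ^ 2] := by
  induction s with
  | zero =>
    intro a ha
    have := hc 0 (a 0) (ha 0 (by omega))
    simp [hc0] at this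
    simp [this]
  | succ s ih =>
    intro a ha
    have h1 := ih (fun j => a (j + 1)) (fun j hj => ha (j + 1) (by omega))
    have h2 := aux_mod m c hc0 hc s (fun j => a (j + 2)) (fun j hj => ha (j + 2) (by omega))
    have h3 := aux_S m c hc (∑ j ∈ range s, a (j + 2) * m ^ j) (a 1) (ha 1 (by omega)).le
    have e := aux_shift m s (fun j => a (j + 1))
    simp only [zero_add, add_assoc, Nat.reduceAdd] at e
    rw [← e] at h3
    have h4 := h3.trans (h2.mul_left _)
    rw [aux_shift, hc _ _ (ha 0 (by omega)), prod_range_succ',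
      sum_range_succ' (fun i => (a (i + 1) : ℤ) ^ 2 * _)]
    have e1 : ∏ j ∈ range (s + 1 + 1),
        (if j ≠ 0 + 1 ∧ j ≠ 0 then (2 * (a j : ℤ) + 1) else 1)
        = ∏ j ∈ range s, (2 * (a (j + 2) : ℤ) + 1) := by
      rw [prod_range_succ', prod_range_succ']; simp
    have e2 : ∀ i, ∏ j ∈ range (s + 1 + 1),
        (if j ≠ i + 1 + 1 ∧ j ≠ i + 1 then (2 * (a j : ℤ) + 1) else 1)
        = (∏ j ∈ range (s + 1),
          (if j ≠ i + 1 ∧ j ≠ i then (2 * (a (j + 1) : ℤ) + 1) else 1)) * (2 * (a 0 : ℤ) + 1) := by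
      intro i
      rw [prod_range_succ']; simp
    simp only [e1, e2, ← mul_assoc]
    rw [← sum_mul]
    rw [Int.modEq_iff_dvd] at h1 h4 ⊢
    obtain ⟨t, ht⟩ := h1
    obtain ⟨u, hu⟩ := h4
    refine ⟨(2 * a 0 + 1) * t + 2 * u, ?_⟩
    simp only [zero_add]
    linear_combination (2 * (a 0 : ℤ) + 1) * ht + 2 * (m : ℤ) * hu


/-- Theorem 12 (TwCharpowersovbm) of the paper. `ov` is the sequence `ovb_m`. -/
theorem stmt_19 (m : ℕ) (hm : 2 ≤ m)
    (ov : ℕ → ℤ) (hov0 : ov 0 = 1)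
    (hovflat : ∀ n : ℕ, ∀ j : ℕ, j < m → ov (m * n + j) = ov (m * n))
    (hovrec : ∀ n : ℕ, 1 ≤ n → ov (m * n) - ov (m * n - 1) = ov n + ov (n - 1))
    (n s : ℕ) (a : ℕ → ℕ)
    (ha : ∀ j : ℕ, j ≤ s → 1 ≤ a j ∧ a j ≤ m - 1)
    (hn : n = ∑ j ∈ Finset.range (s + 1), a j * m ^ j) :
    ov (m * n) ≡
      (∏ i ∈ Finset.range (s + 1), (2 * (a i : ℤ) + 1)) +
        2 * (m : ℤ) * ∑ i ∈ Finset.Icc 1 s,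
          ((a i : ℤ) ^ 2) *
            ∏ j ∈ (Finset.range (s + 1)).filter (fun j => j ≠ i ∧ j ≠ i - 1),
              (2 * (a j : ℤ) + 1)
      [ZMOD ((m : ℤ) ^ 2)] := by
  have h := aux_main m (fun k => ov (m * k)) (by simpa using hov0)
    (fun q r hr => aux_c m hm ov hov0 hovflat hovrec q r hr) s a
    (fun j hj => by have := ha j (by omega); omega)
  rw [← hn] at h
  rw [Finset.range_eq_Ico, Finset.range_eq_Ico] at h
  have e : Finset.Icc 1 s = Finset.Ico (0 + 1) (s + 1) := by ext; simp
  rw [e, ← Finset.sum_Ico_add' _ 0 s 1]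
  simp only [Finset.prod_filter, Nat.add_sub_cancel, Finset.range_eq_Ico]
  simpa only [Finset.range_eq_Ico] using h
end
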